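/- arXiv:2406.15868 — 4 statements merged into one kernel-verified Lean document; each statement's English description precedes it below -/
import Mathlib

section
/- Let k be an algebraically closed field and let S = V(f) ⊆ P³ be a smooth surface of degree d ≥ 3 containing exactly d²(d²−3d+3) lines. Let L be a line on S and let H be a plane containing exactly d lines of S with L ⊄ H. Then there is exactly one line M on S with M ⊆ H and M ∩ L ≠ 0, and the unique plane containing both L and M contains exactly d lines of S. -/
open MvPolynomial

/-- `W` is a line (2-dimensional linear subspace of `k⁴`) lying on the surface `V(f) ⊆ P³`. -/
def IsLineOn {k : Type*} [Field k] (f : MvPolynomial (Fin 4) k)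
    (W : Submodule k (Fin 4 → k)) : Prop :=
  Module.finrank k W = 2 ∧ ∀ v ∈ W, MvPolynomial.eval v f = 0

/-- `f` is a nonzero homogeneous polynomial of degree `d` in `k[x,y,z,w]` such that `f` and its
four partial derivatives have no common zero in `k⁴ ∖ {0}`; i.e. `V(f) ⊆ P³` is a smooth
surface of degree `d`. -/
def IsSmoothSurface {k : Type*} [Field k] (f : MvPolynomial (Fin 4) k) (d : ℕ) : Prop :=
  f ≠ 0 ∧ f.IsHomogeneous d ∧
    ∀ v : Fin 4 → k, v ≠ 0 →
      ¬ (MvPolynomial.eval v f = 0 ∧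
         ∀ i : Fin 4, MvPolynomial.eval v (MvPolynomial.pderiv i f) = 0)

section General

variable {k : Type*} [Field k]

/-- The automorphism of a polynomial ring given by translation of the variables. -/
noncomputable def translateEquiv {σ : Type*} (a : σ → k) :
    MvPolynomial σ k ≃ₐ[k] MvPolynomial σ k :=
  AlgEquiv.ofAlgHom (aeval fun i => X i + C (a i)) (aeval fun i => X i - C (a i))
    (by ext i; simp [← algebraMap_eq]) (by ext i; simp [← algebraMap_eq])

theorem eval_translateEquiv {σ : Type*} (a v : σ → k) (p : MvPolynomial σ k) :
    eval v (translateEquiv a p) = eval (v + a) p := by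
  have : (eval v).comp ((translateEquiv a : MvPolynomial σ k →ₐ[k] MvPolynomial σ k) :
      MvPolynomial σ k →+* MvPolynomial σ k) = eval (v + a) := by
    ext i <;> simp [translateEquiv]
  exact congrArg (fun φ => φ p) this

theorem height_vanishingIdeal_singleton [IsAlgClosed k] {n : ℕ} (x : Fin n → k) :
    (vanishingIdeal k {x} : Ideal (MvPolynomial (Fin n) k)).height = n := by
  have key : ∀ x y : Fin n → k, (vanishingIdeal k {x} : Ideal (MvPolynomial (Fin n) k)).height =
      (vanishingIdeal k {y} : Ideal (MvPolynomial (Fin n) k)).height := by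
    intro x y
    rw [← RingEquiv.height_comap (translateEquiv (y - x)).toRingEquiv]
    congr 1
    ext p
    have h := eval_translateEquiv (y - x) x p
    rw [add_sub_cancel] at h
    simp only [Ideal.mem_comap, mem_vanishingIdeal_singleton_iff]
    simpa [aeval_eq_eval] using Eq.congr_left h
  have hdim : ringKrullDim (MvPolynomial (Fin n) k) = n := by
    simp [ringKrullDim_eq_zero_of_field]
  have : FiniteRingKrullDim (MvPolynomial (Fin n) k) :=
    finiteRingKrullDim_iff_ne_bot_and_top.mpr (by
      rw [hdim]
      exact ⟨WithBot.natCast_ne_bot n, fun h =>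
        ENat.natCast_ne_top n (WithBot.coe_injective h)⟩)
  obtain ⟨m, hm, hh⟩ := Ideal.exists_isMaximal_height (R := MvPolynomial (Fin n) k)
  obtain ⟨y, rfl⟩ := isMaximal_iff_eq_vanishingIdeal_singleton.mp hm
  rw [hdim] at hh
  rw [key x y]
  exact_mod_cast hh

/-- Fewer than `n` polynomials in `n` variables which vanish at the origin have another common
zero. -/
theorem exists_ne_zero_forall_eval_eq_zero [IsAlgClosed k] {n : ℕ}
    (s : Finset (MvPolynomial (Fin n) k)) (hs : s.card < n) (h0 : ∀ p ∈ s, eval 0 p = 0) :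
    ∃ v : Fin n → k, v ≠ 0 ∧ ∀ p ∈ s, eval v p = 0 := by
  by_contra! hcon
  have hz : zeroLocus k (Ideal.span (s : Set (MvPolynomial (Fin n) k))) = {0} := by
    ext v
    rw [zeroLocus_span]
    constructor
    · intro hv
      by_contra hne
      obtain ⟨p, hp, hpv⟩ := hcon v hne
      exact hpv (by simpa [aeval_eq_eval] using hv p hp)
    · rintro rfl p hp
      simpa [aeval_eq_eval] using h0 p hp
  have hrad := vanishingIdeal_zeroLocus_eq_radical (K := k)
    (Ideal.span (s : Set (MvPolynomial (Fin n) k)))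
  rw [hz] at hrad
  have hmax : (vanishingIdeal k {(0 : Fin n → k)} : Ideal (MvPolynomial (Fin n) k)).IsMaximal :=
    isMaximal_iff_eq_vanishingIdeal_singleton.mpr ⟨0, rfl⟩
  have hmin : (vanishingIdeal k {(0 : Fin n → k)} : Ideal (MvPolynomial (Fin n) k)) ∈
      (Ideal.span (s : Set (MvPolynomial (Fin n) k))).minimalPrimes := by
    rw [← Ideal.radical_minimalPrimes, ← hrad, Ideal.minimalPrimes_eq_subsingleton_self]
    rfl
  have h1 := Ideal.height_le_card_of_mem_minimalPrimes_span_finset hmin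
  rw [height_vanishingIdeal_singleton] at h1
  exact absurd (by exact_mod_cast h1) (not_le.mpr hs)

/-- A polynomial vanishing on the zero locus of an irreducible `p` is divisible by `p`. -/
theorem Irreducible.dvd_of_forall_eval_eq_zero [IsAlgClosed k] {σ : Type*} [Finite σ]
    {p q : MvPolynomial σ k} (hp : Irreducible p) (h : ∀ v, eval v p = 0 → eval v q = 0) :
    p ∣ q := by
  have hprime : (Ideal.span {p}).IsPrime :=
    (Ideal.span_singleton_prime hp.ne_zero).mpr hp.prime
  rw [← Ideal.mem_span_singleton, ← IsPrime.vanishingIdeal_zeroLocus (K := k) (Ideal.span {p})]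
  intro v hv
  have := h v (by simpa [aeval_eq_eval] using hv p (Ideal.mem_span_singleton_self p))
  simpa [aeval_eq_eval] using this

/-- The ring map sending `p(x)` to `p(x T)`. -/
noncomputable def scaleHom (σ k : Type*) [Field k] :
    MvPolynomial σ k →ₐ[k] Polynomial (MvPolynomial σ k) :=
  aeval fun i => Polynomial.C (X i) * Polynomial.X

theorem coeff_scaleHom {σ : Type*} (p : MvPolynomial σ k) (n : ℕ) :
    (scaleHom σ k p).coeff n = homogeneousComponent n p := by
  induction p using MvPolynomial.induction_on' with
  | monomial u a =>
    have : scaleHom σ k (monomial u a) =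
        Polynomial.C (monomial u a) * Polynomial.X ^ u.degree := by
      have h1 : (u.prod fun _ e => (Polynomial.X : Polynomial (MvPolynomial σ k)) ^ e) =
          Polynomial.X ^ u.degree := by
        rw [Finsupp.prod, Finset.prod_pow_eq_pow_sum]
        rfl
      have h2 : (u.prod fun i e => (Polynomial.C (X i : MvPolynomial σ k)) ^ e) =
          Polynomial.C (u.prod fun i e => X i ^ e) := by
        rw [Finsupp.prod, Finsupp.prod, map_prod]
        simp only [map_pow]
      have h3 : algebraMap k (Polynomial (MvPolynomial σ k)) a =
          Polynomial.C (C a : MvPolynomial σ k) := rfl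
      rw [scaleHom, aeval_monomial]
      simp only [mul_pow]
      rw [Finsupp.prod_mul, h1, h2, h3, monomial_eq (s := u), Polynomial.C_mul, mul_assoc]
    rw [this, Polynomial.coeff_C_mul_X_pow]
    split_ifs with h
    · rw [h, homogeneousComponent_of_mem (isHomogeneous_monomial a rfl), if_pos rfl]
    · rw [homogeneousComponent_of_mem (isHomogeneous_monomial a rfl), if_neg h]
  | add p q hp hq => simp [hp, hq]

theorem scaleHom_injective {σ : Type*} : Function.Injective (scaleHom σ k) := by
  intro p q h
  ext u
  have := congrArg (fun r => coeff u (r.coeff u.degree)) h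
  simpa [coeff_scaleHom, coeff_homogeneousComponent] using this

theorem isHomogeneous_iff_scaleHom {σ : Type*} {p : MvPolynomial σ k} {n : ℕ} :
    p.IsHomogeneous n ↔ scaleHom σ k p = Polynomial.C p * Polynomial.X ^ n := by
  constructor
  · intro h
    ext1 m
    rw [coeff_scaleHom, Polynomial.coeff_C_mul_X_pow, homogeneousComponent_of_mem h]
  · intro h
    have := coeff_scaleHom p n
    rw [h, Polynomial.coeff_C_mul_X_pow, if_pos rfl] at this
    rw [this]
    exact homogeneousComponent_isHomogeneous n p

theorem MvPolynomial.IsHomogeneous.exists_of_mul {σ : Type*} {p q : MvPolynomial σ k} {n : ℕ}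
    (h : (p * q).IsHomogeneous n) (h0 : p * q ≠ 0) :
    ∃ a b, a + b = n ∧ p.IsHomogeneous a ∧ q.IsHomogeneous b := by
  have h' := isHomogeneous_iff_scaleHom.mp h
  have hp : scaleHom σ k p ≠ 0 := fun e =>
    left_ne_zero_of_mul h0 (scaleHom_injective (by rw [e, map_zero]))
  have hq : scaleHom σ k q ≠ 0 := fun e =>
    right_ne_zero_of_mul h0 (scaleHom_injective (by rw [e, map_zero]))
  rw [map_mul] at h'
  have hdeg := congrArg Polynomial.natDegree h'
  have htr := congrArg Polynomial.natTrailingDegree h'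
  rw [Polynomial.natDegree_mul hp hq, Polynomial.natDegree_C_mul_X_pow n _ h0] at hdeg
  rw [Polynomial.natTrailingDegree_mul hp hq, Polynomial.C_mul_X_pow_eq_monomial,
    Polynomial.natTrailingDegree_monomial h0] at htr
  have key : ∀ r : MvPolynomial σ k,
      (scaleHom σ k r).natDegree = (scaleHom σ k r).natTrailingDegree →
      r.IsHomogeneous (scaleHom σ k r).natDegree := by
    intro r hr
    rw [MvPolynomial.IsHomogeneous, IsWeightedHomogeneous]
    intro u hu
    have hu' : (scaleHom σ k r).coeff u.degree ≠ 0 := by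
      intro e
      have := congrArg (coeff u) e
      simp [coeff_scaleHom, coeff_homogeneousComponent, hu] at this
    have h1 := Polynomial.le_natDegree_of_ne_zero hu'
    have h2 := Polynomial.natTrailingDegree_le_of_ne_zero hu'
    have : u.degree = (scaleHom σ k r).natDegree := by omega
    rw [← this, Finsupp.degree_eq_weight_one]
    rfl
  have h1 := Polynomial.natTrailingDegree_le_natDegree (scaleHom σ k p)
  have h2 := Polynomial.natTrailingDegree_le_natDegree (scaleHom σ k q)
  exact ⟨_, _, hdeg, key p (by omega), key q (by omega)⟩

end General

section Bezout

variable {K : Type*} [Field K]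

theorem finrank_restrictTotalDegree_fin_two (e : ℕ) :
    2 * Module.finrank K (restrictTotalDegree (Fin 2) K e) = (e + 1) * (e + 2) := by
  have hcard : Nat.card {u : Fin 2 →₀ ℕ | (u.sum fun _ n => n) ≤ e} =
      ((Finset.range (e + 1)).sigma fun j => Finset.HasAntidiagonal.antidiagonal j).card := by
    have hsum : ∀ u : Fin 2 →₀ ℕ, (u.sum fun _ n => n) = u 0 + u 1 := fun u => by
      rw [Finsupp.sum_fintype _ _ fun _ => rfl, Fin.sum_univ_two]
    rw [← Set.ncard_coe_finset, ← Nat.card_coe_set_eq]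
    refine Nat.card_congr
      { toFun := fun u => ⟨⟨u.1 0 + u.1 1, (u.1 0, u.1 1)⟩, ?_⟩
        invFun := fun x => ⟨Finsupp.equivFunOnFinite.symm ![x.1.2.1, x.1.2.2], ?_⟩
        left_inv := fun u => ?_
        right_inv := fun x => ?_ }
    · have := u.2
      rw [Set.mem_ofPred_eq, hsum] at this
      simpa [Nat.lt_succ_iff] using this
    · have := x.2
      simp only [Finset.coe_sigma, Set.mem_sigma_iff, Finset.mem_coe, Finset.mem_range] at this
      rw [Set.mem_ofPred_eq, hsum]
      simpa using (Finset.HasAntidiagonal.mem_antidiagonal.mp this.2).trans_le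
        (Nat.le_of_lt_succ this.1)
    · ext i
      fin_cases i <;> simp
    · obtain ⟨⟨j, a, b⟩, hx⟩ := x
      simp only [Finset.coe_sigma, Set.mem_sigma_iff, Finset.mem_coe, Finset.mem_range] at hx
      obtain rfl := Finset.HasAntidiagonal.mem_antidiagonal.mp hx.2
      simp
  have h1 : Module.finrank K (restrictTotalDegree (Fin 2) K e) =
      Nat.card {u : Fin 2 →₀ ℕ | (u.sum fun _ n => n) ≤ e} :=
    Module.finrank_eq_nat_card_basis (basisRestrictSupport K _)
  rw [h1, hcard, Finset.card_sigma]
  simp only [Finset.Nat.card_antidiagonal]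
  clear hcard h1
  induction e with
  | zero => rfl
  | succ e ih => rw [Finset.sum_range_succ, mul_add, ih]; ring

theorem exists_eval_eq_pi_single {σ : Type*} (S : Finset (σ → K)) (s : σ → K) :
    ∃ p : MvPolynomial σ K, eval s p = 1 ∧ ∀ t ∈ S, t ≠ s → eval t p = 0 := by
  classical
  induction S using Finset.induction_on with
  | empty => exact ⟨1, by simp⟩
  | insert a S _ ih =>
    obtain ⟨p, hp, hS⟩ := ih
    by_cases ha : a = s
    · exact ⟨p, hp, fun t ht hts => hS t (by simpa [ha, hts] using ht) hts⟩
    · obtain ⟨i, hi⟩ := Function.ne_iff.mp ha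
      refine ⟨p * (C (s i - a i)⁻¹ * (X i - C (a i))), ?_, ?_⟩
      · simp [hp, inv_mul_cancel₀ (sub_ne_zero.mpr (Ne.symm hi))]
      · intro t ht hts
        rcases Finset.mem_insert.mp ht with rfl | ht
        · simp
        · simp [hS t ht hts]

/-- Bézout's inequality in the affine plane. -/
theorem card_le_totalDegree_mul_totalDegree {F G : MvPolynomial (Fin 2) K} (hF : F ≠ 0)
    (hG : G ≠ 0) (h : IsRelPrime F G) (S : Finset (Fin 2 → K))
    (hS : ∀ s ∈ S, eval s F = 0 ∧ eval s G = 0) :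
    S.card ≤ F.totalDegree * G.totalDegree := by
  classical
  choose p hp hp' using exists_eval_eq_pi_single S
  set m := F.totalDegree
  set n := G.totalDegree
  obtain ⟨e, he⟩ : ∃ e, e = m + n + S.sup fun s => (p s).totalDegree := ⟨_, rfl⟩
  let P := restrictTotalDegree (Fin 2) K
  let ev : MvPolynomial (Fin 2) K →ₗ[K] (S → K) :=
    LinearMap.pi fun s => (aeval (s : Fin 2 → K)).toLinearMap
  let W₁ := (P (e - m)).map (LinearMap.mulLeft K F)
  let W₂ := (P (e - n)).map (LinearMap.mulLeft K G)
  have hd1 : Module.finrank K W₁ = Module.finrank K (P (e - m)) :=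
    (Submodule.equivMapOfInjective _ (fun _ _ h => mul_left_cancel₀ hF h) _).finrank_eq.symm
  have hd2 : Module.finrank K W₂ = Module.finrank K (P (e - n)) :=
    (Submodule.equivMapOfInjective _ (fun _ _ h => mul_left_cancel₀ hG h) _).finrank_eq.symm
  have : FiniteDimensional K (P e) := inferInstanceAs (Module.Finite K (restrictTotalDegree _ K _))
  have : FiniteDimensional K (P (e - m)) :=
    inferInstanceAs (Module.Finite K (restrictTotalDegree _ K _))
  have : FiniteDimensional K (P (e - n)) :=
    inferInstanceAs (Module.Finite K (restrictTotalDegree _ K _))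
  have : FiniteDimensional K (P (e - m - n)) :=
    inferInstanceAs (Module.Finite K (restrictTotalDegree _ K _))
  have hinf : Module.finrank K (W₁ ⊓ W₂ : Submodule K _) ≤ Module.finrank K (P (e - m - n)) := by
    have hle : W₁ ⊓ W₂ ≤ (P (e - m - n)).map (LinearMap.mulLeft K (F * G)) := by
      rintro _ ⟨⟨u, hu, rfl⟩, ⟨v, hv, hvu⟩⟩
      simp only [LinearMap.mulLeft_apply] at hvu ⊢
      obtain ⟨w, rfl⟩ : G ∣ u := h.symm.dvd_of_dvd_mul_left (Dvd.intro _ hvu)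
      refine ⟨w, ?_, by simp⟩
      by_cases hw : w = 0
      · simp [hw]
      have hu' := (mem_restrictTotalDegree _ _ _).mp hu
      rw [totalDegree_mul_of_isDomain hG hw] at hu'
      exact (mem_restrictTotalDegree _ _ _).mpr (by omega)
    exact (Submodule.finrank_mono hle).trans (Submodule.finrank_map_le _ _)
  have hle : W₁ ⊔ W₂ ≤ P e ⊓ LinearMap.ker ev := by
    refine sup_le ?_ ?_
    · rintro _ ⟨u, hu, rfl⟩
      have hu' := (mem_restrictTotalDegree _ _ _).mp hu
      refine ⟨(mem_restrictTotalDegree _ _ _).mpr ?_, ?_⟩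
      · exact (totalDegree_mul _ _).trans (by omega)
      · ext s
        simp [ev, aeval_eq_eval, (hS s s.2).1]
    · rintro _ ⟨u, hu, rfl⟩
      have hu' := (mem_restrictTotalDegree _ _ _).mp hu
      refine ⟨(mem_restrictTotalDegree _ _ _).mpr ?_, ?_⟩
      · exact (totalDegree_mul _ _).trans (by omega)
      · ext s
        simp [ev, aeval_eq_eval, (hS s s.2).2]
  have hsurj : Function.Surjective (ev.domRestrict (P e)) := by
    intro c
    refine ⟨⟨∑ s : S, C (c s) * p s, ?_⟩, ?_⟩
    · refine Submodule.sum_mem _ fun s _ => ?_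
      rw [← smul_eq_C_mul]
      refine Submodule.smul_mem _ _ ((mem_restrictTotalDegree _ _ _).mpr ?_)
      exact (Finset.le_sup (f := fun s => (p s).totalDegree) s.2).trans (by omega)
    · ext t
      simp only [ev, LinearMap.domRestrict_apply, LinearMap.pi_apply, AlgHom.toLinearMap_apply,
        aeval_eq_eval, map_sum, map_mul, eval_C]
      rw [Finset.sum_eq_single t]
      · simp [hp]
      · intro s _ hst
        simp [hp' s t t.2 (fun e => hst (Subtype.ext e.symm))]
      · simp
  have hrk := (ev.domRestrict (P e)).finrank_range_add_finrank_ker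
  rw [LinearMap.range_eq_top.mpr hsurj, finrank_top, Module.finrank_fintype_fun_eq_card,
    Fintype.card_coe] at hrk
  have hker : Module.finrank K (W₁ ⊔ W₂ : Submodule K _) ≤
      Module.finrank K (LinearMap.ker (ev.domRestrict (P e))) := by
    rw [← (Submodule.comapSubtypeEquivOfLe (hle.trans inf_le_left)).finrank_eq]
    exact Submodule.finrank_mono fun x hx => (hle hx).2
  have hsum := Submodule.finrank_sup_add_finrank_inf_eq W₁ W₂
  have e0 := finrank_restrictTotalDegree_fin_two (K := K) e
  have e1 := finrank_restrictTotalDegree_fin_two (K := K) (e - m)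
  have e2 := finrank_restrictTotalDegree_fin_two (K := K) (e - n)
  have e3 := finrank_restrictTotalDegree_fin_two (K := K) (e - m - n)
  obtain ⟨r, rfl⟩ : ∃ r, e = m + n + r := ⟨_, he⟩
  rw [show m + n + r - m = n + r by omega] at *
  rw [show m + n + r - n = m + r by omega] at *
  rw [show n + r - n = r by omega] at *
  simp only [P] at *
  linarith

end Bezout

section Homogeneous

variable {k : Type*} [Field k] {σ : Type*}

theorem MvPolynomial.IsHomogeneous.aeval_smul {A : Type*} [CommRing A] [Algebra k A]
    {p : MvPolynomial σ k} {n : ℕ} (h : p.IsHomogeneous n) (t : A) (g : σ → A) :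
    MvPolynomial.aeval (t • g) p = t ^ n * MvPolynomial.aeval g p := by
  have : (MvPolynomial.aeval (t • g) : MvPolynomial σ k →ₐ[k] A).toRingHom =
      (Polynomial.eval₂RingHom (MvPolynomial.aeval g : MvPolynomial σ k →ₐ[k] A).toRingHom t).comp
        (scaleHom σ k).toRingHom := by
    ext i
    · simp [scaleHom]
    · simpa [scaleHom] using mul_comm _ _
  have h2 := congrArg (fun φ => φ p) this
  simp only [AlgHom.toRingHom_eq_coe, RingHom.coe_coe, RingHom.comp_apply,
    isHomogeneous_iff_scaleHom.mp h] at h2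
  rw [h2, map_mul, map_pow]
  simpa using mul_comm _ _

theorem MvPolynomial.IsHomogeneous.eval_smul {p : MvPolynomial σ k} {n : ℕ}
    (h : p.IsHomogeneous n) (t : k) (v : σ → k) : eval (t • v) p = t ^ n * eval v p := by
  simpa [aeval_eq_eval] using h.aeval_smul t v

theorem MvPolynomial.IsHomogeneous.eval_zero {p : MvPolynomial σ k} {n : ℕ}
    (h : p.IsHomogeneous n) (hn : n ≠ 0) : eval 0 p = 0 := by
  simpa [hn] using h.eval_smul 0 (0 : σ → k)

theorem MvPolynomial.IsHomogeneous.isUnit_of_ne_zero {p : MvPolynomial σ k}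
    (h : p.IsHomogeneous 0) (hp : p ≠ 0) : IsUnit p := by
  refine isUnit_iff_totalDegree_of_isReduced.mpr ⟨isUnit_iff_ne_zero.mpr fun h0 => hp ?_,
    h.totalDegree hp⟩
  rw [totalDegree_eq_zero_iff_eq_C.mp (h.totalDegree hp), h0, C_0]

/-- The chain rule for derivations. -/
theorem Derivation.apply_aeval {A : Type*} [CommRing A] [Algebra k A] [Fintype σ]
    (D : Derivation k A A) (g : σ → A) (p : MvPolynomial σ k) :
    D (aeval g p) = ∑ i, aeval g (pderiv i p) * D (g i) := by
  classical
  induction p using MvPolynomial.induction_on with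
  | C a => simp
  | add p q hp hq => simp [hp, hq, add_mul, Finset.sum_add_distrib]
  | mul_X p i hp =>
    simp only [map_mul, aeval_X, Derivation.leibniz, smul_eq_mul, hp, pderiv_X, map_add,
      Finset.mul_sum, add_mul, Finset.sum_add_distrib, Pi.single_apply, apply_ite (aeval g),
      map_zero, mul_ite, ite_mul, mul_one, mul_zero, zero_mul, Finset.sum_ite_eq,
      Finset.mem_univ, if_true]
    congr 1
    exact Finset.sum_congr rfl fun j _ => by ring

/-- The derivative of `p` at `q` along `w`, as a linear functional of `w`. -/
noncomputable def gradientAt [Fintype σ] (p : MvPolynomial σ k) (q : σ → k) : (σ → k) →ₗ[k] k :=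
  ∑ i, eval q (pderiv i p) • LinearMap.proj i

theorem gradientAt_apply [Fintype σ] (p : MvPolynomial σ k) (q w : σ → k) :
    gradientAt p q w = ∑ i, eval q (pderiv i p) * w i := by
  simp [gradientAt]

theorem gradientAt_single [Fintype σ] [DecidableEq σ] (p : MvPolynomial σ k) (q : σ → k) (i : σ) :
    gradientAt p q (Pi.single i 1) = eval q (pderiv i p) := by
  simp [gradientAt_apply, Pi.single_apply]

theorem gradientAt_eq_zero_of_mem [Infinite k] [Fintype σ] {p : MvPolynomial σ k}
    {W : Submodule k (σ → k)} (hW : ∀ v ∈ W, eval v p = 0) {q w : σ → k} (hq : q ∈ W)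
    (hw : w ∈ W) : gradientAt p q w = 0 := by
  let g : σ → Polynomial k := fun i => Polynomial.C (q i) + Polynomial.C (w i) * Polynomial.X
  have hg : ∀ (t : k) (r : MvPolynomial σ k),
      (aeval g r : Polynomial k).eval t = eval (q + t • w) r := by
    intro t r
    have : (Polynomial.evalRingHom t).comp (aeval g : MvPolynomial σ k →ₐ[k] _).toRingHom =
        eval (q + t • w) := by
      ext i <;> simp [g, mul_comm t]
    exact congrArg (fun φ => φ r) this
  have h0 : (aeval g p : Polynomial k) = 0 := Polynomial.funext fun t => by
    rw [hg, Polynomial.eval_zero]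
    exact hW _ (W.add_mem hq (W.smul_mem t hw))
  have h1 := Derivation.apply_aeval (Polynomial.derivative' (R := k)) g p
  have h2 := congrArg (Polynomial.eval 0) h1
  simpa [h0, gradientAt_apply, Polynomial.eval_finsetSum, hg, g] using h2.symm

end Homogeneous

section LinearSubstitution

variable {k : Type*} [Field k] {m n : ℕ}

/-- Pull back of polynomial functions along a linear map. -/
noncomputable def linSubst (A : (Fin m → k) →ₗ[k] (Fin n → k)) :
    MvPolynomial (Fin n) k →ₐ[k] MvPolynomial (Fin m) k :=
  aeval fun i => ∑ j, C (A (Pi.single j 1) i) * X j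

theorem eval_linSubst (A : (Fin m → k) →ₗ[k] (Fin n → k)) (v : Fin m → k)
    (p : MvPolynomial (Fin n) k) : eval v (linSubst A p) = eval (A v) p := by
  have : (eval v).comp (linSubst A).toRingHom = eval (A v) := by
    ext i
    · simp [linSubst]
    · simp only [linSubst, AlgHom.toRingHom_eq_coe, RingHom.coe_comp, RingHom.coe_coe,
        Function.comp_apply, aeval_X, map_sum, map_mul, eval_C, eval_X]
      conv_rhs => rw [pi_eq_sum_univ' v, map_sum, Finset.sum_apply]
      exact Finset.sum_congr rfl fun j _ => by simp [mul_comm]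
  exact congrArg (fun φ => φ p) this

theorem isHomogeneous_linSubst (A : (Fin m → k) →ₗ[k] (Fin n → k)) {p : MvPolynomial (Fin n) k}
    {d : ℕ} (hp : p.IsHomogeneous d) : (linSubst A p).IsHomogeneous d := by
  have := hp.aeval (fun i => ∑ j, C (A (Pi.single j 1) i) * X j) (n := 1) fun i =>
    IsHomogeneous.sum _ _ _ fun j _ => (isHomogeneous_X k j).C_mul _
  rwa [one_mul] at this

theorem gradientAt_linSubst (A : (Fin m → k) →ₗ[k] (Fin n → k)) (p : MvPolynomial (Fin n) k)
    (q w : Fin m → k) : gradientAt (linSubst A p) q w = gradientAt p (A q) (A w) := by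
  suffices h : gradientAt (linSubst A p) q = gradientAt p (A q) ∘ₗ A from
    congrArg (fun φ => φ w) h
  refine LinearMap.pi_ext' fun j => LinearMap.ext_ring ?_
  have h1 := Derivation.apply_aeval (pderiv j) (fun i => ∑ j, C (A (Pi.single j 1) i) * X j) p
  have h2 := congrArg (eval q) h1
  simp only [map_sum, map_mul] at h2
  simp only [LinearMap.comp_apply, LinearMap.single_apply, gradientAt_single, linSubst]
  rw [gradientAt_apply]
  refine h2.trans (Finset.sum_congr rfl fun i _ => ?_)
  have := eval_linSubst A q (pderiv i p)
  rw [linSubst] at this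
  rw [this]
  simp [Pi.single_apply, apply_ite (eval q)]

end LinearSubstitution

section Hyperplane

variable {k : Type*} [Field k] {n : ℕ}

theorem exists_irreducible_of_finrank_add_one {W : Submodule k (Fin n → k)}
    (hW : Module.finrank k W + 1 = n) :
    ∃ p : MvPolynomial (Fin n) k, p.IsHomogeneous 1 ∧ Irreducible p ∧
      ∀ v, eval v p = 0 ↔ v ∈ W := by
  have hlt : W < ⊤ := by
    rw [lt_top_iff_ne_top]
    rintro rfl
    simp at hW
  obtain ⟨φ, hφ, hle⟩ := Submodule.exists_le_ker_of_lt_top W hlt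
  have hker : W = LinearMap.ker φ := by
    refine Submodule.eq_of_le_of_finrank_eq hle ?_
    have := Module.Dual.finrank_ker_add_one_of_ne_zero hφ
    rw [Module.finrank_fin_fun] at this
    omega
  let p : MvPolynomial (Fin n) k := ∑ i, C (φ (Pi.single i 1)) * X i
  have hev : ∀ v, eval v p = φ v := fun v => by
    conv_rhs => rw [pi_eq_sum_univ' v, map_sum]
    simp [p, mul_comm]
  have hhom : p.IsHomogeneous 1 :=
    IsHomogeneous.sum _ _ _ fun j _ => (isHomogeneous_X k j).C_mul _
  have h0 : p ≠ 0 := by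
    rintro h
    exact hφ (LinearMap.ext fun v => by rw [← hev v, h]; simp)
  refine ⟨p, hhom, ?_, fun v => by rw [hev, hker, LinearMap.mem_ker]⟩
  refine irreducible_of_totalDegree_eq_one (hhom.totalDegree h0) fun x hx => ?_
  obtain ⟨u, hu⟩ := ne_zero_iff.mp h0
  exact isUnit_iff_ne_zero.mpr fun h => hu (zero_dvd_iff.mp (h ▸ hx u))

/-- A form of degree `d` in `n` variables vanishes on at most `d` hyperplanes; if it vanishes on
exactly `d` hyperplanes, it vanishes nowhere else. -/
theorem card_hyperplanes_le [IsAlgClosed k] {g : MvPolynomial (Fin n) k} {d : ℕ} (hg : g ≠ 0)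
    (hd : g.IsHomogeneous d) (s : Finset (Submodule k (Fin n → k)))
    (hs : ∀ W ∈ s, Module.finrank k W + 1 = n ∧ ∀ v ∈ W, eval v g = 0) :
    s.card ≤ d ∧ (s.card = d → ∀ v, eval v g = 0 → ∃ W ∈ s, v ∈ W) := by
  choose p hp1 hp2 hp3 using fun W : s => exists_irreducible_of_finrank_add_one (hs W W.2).1
  have hdvd : ∏ W, p W ∣ g := by
    refine Finset.prod_dvd_of_isRelPrime (fun W _ W' _ hne => ?_) fun W _ => ?_
    · refine ((hp2 W).isRelPrime_iff_not_dvd).mpr fun hdiv => hne ?_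
      have hass := (hp2 W).associated_of_dvd (hp2 W') hdiv
      refine Subtype.ext (Submodule.ext fun v => ?_)
      rw [← hp3 W, ← hp3 W']
      obtain ⟨u, hu⟩ := hass
      rw [← hu, map_mul]
      have : IsUnit (eval v (u : MvPolynomial (Fin n) k)) := u.isUnit.map _
      simp [this.ne_zero]
    · exact (hp2 W).dvd_of_forall_eval_eq_zero fun v hv => (hs W W.2).2 v ((hp3 W v).mp hv)
  obtain ⟨c, hc⟩ := hdvd
  have hc0 : c ≠ 0 := by rintro rfl; exact hg (by rw [hc, mul_zero])
  have hprod : (∏ W, p W) ≠ 0 := Finset.prod_ne_zero_iff.mpr fun W _ => (hp2 W).ne_zero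
  have hprodhom : (∏ W, p W).IsHomogeneous s.card := by
    have := IsHomogeneous.prod Finset.univ p (fun _ => 1) fun W _ => hp1 W
    simpa using this
  have hdeg := hd.totalDegree hg
  rw [hc, totalDegree_mul_of_isDomain hprod hc0, hprodhom.totalDegree hprod] at hdeg
  refine ⟨by omega, fun hcard v hv => ?_⟩
  have hc1 : c.totalDegree = 0 := by omega
  rw [totalDegree_eq_zero_iff_eq_C] at hc1
  have hcoeff : coeff 0 c ≠ 0 := fun h => hc0 (by rw [hc1, h, C_0])
  rw [hc, map_mul, hc1, eval_C, mul_eq_zero, or_iff_left hcoeff, map_prod,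
    Finset.prod_eq_zero_iff] at hv
  obtain ⟨W, -, hW⟩ := hv
  exact ⟨W, W.2, (hp3 W v).mp hW⟩

end Hyperplane

section Surface

variable {k : Type*} [Field k] {f : MvPolynomial (Fin 4) k} {d : ℕ}

theorem IsSmoothSurface.gradientAt_ne_zero (hf : IsSmoothSurface f d) {v : Fin 4 → k} (hv : v ≠ 0)
    (hfv : eval v f = 0) : gradientAt f v ≠ 0 := fun h =>
  hf.2.2 v hv ⟨hfv, fun i => by rw [← gradientAt_single, h, LinearMap.zero_apply]⟩

variable [IsAlgClosed k]

theorem IsSmoothSurface.irreducible (hf : IsSmoothSurface f d) (hd : d ≠ 0) :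
    Irreducible f := by
  have hf0 := hf.2.1.eval_zero hd
  refine ⟨fun hu => (hu.map (eval 0)).ne_zero hf0, fun g h hgh => ?_⟩
  obtain ⟨a, b, -, hg, hh⟩ := IsHomogeneous.exists_of_mul (hgh ▸ hf.2.1) (hgh ▸ hf.1)
  rcases eq_or_ne a 0 with rfl | ha
  · exact Or.inl (hg.isUnit_of_ne_zero fun h0 => hf.1 (by rw [hgh, h0, zero_mul]))
  rcases eq_or_ne b 0 with rfl | hb
  · exact Or.inr (hh.isUnit_of_ne_zero fun h0 => hf.1 (by rw [hgh, h0, mul_zero]))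
  classical
  obtain ⟨v, hv, hvz⟩ := exists_ne_zero_forall_eval_eq_zero {g, h}
    ((Finset.card_le_two).trans_lt (by norm_num)) (by
      simp only [Finset.mem_insert, Finset.mem_singleton, forall_eq_or_imp, forall_eq]
      exact ⟨hg.eval_zero ha, hh.eval_zero hb⟩)
  simp only [Finset.mem_insert, Finset.mem_singleton, forall_eq_or_imp, forall_eq] at hvz
  exact absurd ⟨by simp [hgh, hvz.1], fun i => by simp [hgh, hvz.1, hvz.2]⟩ (hf.2.2 v hv)

/-- The lines on a smooth surface through a point lie in the tangent plane at that point. -/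
theorem IsSmoothSurface.sup_ne_top (hf : IsSmoothSurface f d) {v : Fin 4 → k} (hv : v ≠ 0)
    {N₁ N₂ N₃ : Submodule k (Fin 4 → k)} (h₁ : IsLineOn f N₁) (h₂ : IsLineOn f N₂)
    (h₃ : IsLineOn f N₃) (hv₁ : v ∈ N₁) (hv₂ : v ∈ N₂) (hv₃ : v ∈ N₃) :
    N₁ ⊔ N₂ ⊔ N₃ ≠ ⊤ := by
  intro htop
  refine hf.gradientAt_ne_zero hv (h₁.2 v hv₁) (LinearMap.ker_eq_top.mp (top_le_iff.mp ?_))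
  rw [← htop]
  exact sup_le (sup_le (fun w hw => gradientAt_eq_zero_of_mem h₁.2 hv₁ hw)
    fun w hw => gradientAt_eq_zero_of_mem h₂.2 hv₂ hw)
    fun w hw => gradientAt_eq_zero_of_mem h₃.2 hv₃ hw

theorem IsSmoothSurface.comp_linearEquiv (hf : IsSmoothSurface f d)
    (A : (Fin 4 → k) ≃ₗ[k] (Fin 4 → k)) :
    IsSmoothSurface (linSubst (A : (Fin 4 → k) →ₗ[k] (Fin 4 → k)) f) d := by
  refine ⟨fun h => hf.1 (MvPolynomial.funext fun v => ?_), isHomogeneous_linSubst _ hf.2.1,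
    fun v hv hs => ?_⟩
  · have := eval_linSubst (A : (Fin 4 → k) →ₗ[k] (Fin 4 → k)) (A.symm v) f
    simpa [h] using this.symm
  · rw [eval_linSubst] at hs
    refine hf.gradientAt_ne_zero (v := A v) (by simpa using hv) hs.1 (LinearMap.ext fun w => ?_)
    have := gradientAt_linSubst (A : (Fin 4 → k) →ₗ[k] (Fin 4 → k)) f v (A.symm w)
    simp only [LinearEquiv.coe_coe, LinearEquiv.apply_symm_apply] at this
    rw [← this, gradientAt_apply]
    simp [hs.2]

theorem IsSmoothSurface.exists_eval_ne_zero (hf : IsSmoothSurface f d) (hd : 2 ≤ d)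
    {P : Submodule k (Fin 4 → k)} (hP : Module.finrank k P = 3) :
    ∃ v ∈ P, eval v f ≠ 0 := by
  by_contra! hcon
  obtain ⟨p, hp1, hp2, hp3⟩ := exists_irreducible_of_finrank_add_one (W := P) (by omega)
  have hdvd := hp2.dvd_of_forall_eval_eq_zero fun v hv => hcon v ((hp3 v).mp hv)
  obtain ⟨u, hu⟩ := hp2.associated_of_dvd (hf.irreducible (by omega)) hdvd
  have h1 := hf.2.1.totalDegree hf.1
  rw [← hu, totalDegree_mul_of_isDomain hp2.ne_zero u.ne_zero, hp1.totalDegree hp2.ne_zero,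
    (isUnit_iff_totalDegree_of_isReduced.mp u.isUnit).2] at h1
  omega

/-- A plane contains at most `d` lines of a smooth surface of degree `d`; if it contains exactly
`d` of them, these cover the plane section. -/
theorem IsSmoothSurface.card_lines_in_plane_le (hf : IsSmoothSurface f d) (hd : 2 ≤ d)
    {P : Submodule k (Fin 4 → k)} (hP : Module.finrank k P = 3)
    (s : Finset (Submodule k (Fin 4 → k))) (hs : ∀ N ∈ s, IsLineOn f N ∧ N ≤ P) :
    s.card ≤ d ∧ (s.card = d → ∀ v ∈ P, eval v f = 0 → ∃ N ∈ s, v ∈ N) := by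
  classical
  let e : (Fin 3 → k) ≃ₗ[k] P := LinearEquiv.ofFinrankEq _ _ (by simp [hP])
  let A : (Fin 3 → k) →ₗ[k] (Fin 4 → k) := P.subtype ∘ₗ e
  have hA : Function.Injective A := P.injective_subtype.comp e.injective
  have hrange : LinearMap.range A = P := by simp [A, LinearMap.range_comp]
  have hmap : ∀ N ≤ P, (N.comap A).map A = N := fun N hN => by
    rw [Submodule.map_comap_eq, hrange, inf_eq_right.mpr hN]
  obtain ⟨v, hv, hfv⟩ := hf.exists_eval_ne_zero hd hP
  have hg : linSubst A f ≠ 0 := fun h => hfv (by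
    have := eval_linSubst A (e.symm ⟨v, hv⟩) f
    simpa [A, h] using this.symm)
  have hinj : Set.InjOn (Submodule.comap A) s := fun N hN N' hN' h => by
    rw [← hmap N (hs N hN).2, ← hmap N' (hs N' hN').2]
    exact congrArg _ h
  have key := card_hyperplanes_le hg (isHomogeneous_linSubst A hf.2.1)
    (s.image (Submodule.comap A)) (by
      simp only [Finset.mem_image, forall_exists_index, and_imp]
      rintro _ N hN rfl
      refine ⟨?_, fun v hv => ?_⟩
      · rw [(Submodule.equivMapOfInjective A hA _).finrank_eq, hmap N (hs N hN).2, (hs N hN).1.1]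
      · rw [eval_linSubst]
        exact (hs N hN).1.2 _ hv)
  rw [Finset.card_image_of_injOn hinj] at key
  refine ⟨key.1, fun h v hv hfv => ?_⟩
  obtain ⟨w, rfl⟩ : v ∈ LinearMap.range A := hrange ▸ hv
  obtain ⟨W, hW, hwW⟩ := key.2 h w (by rwa [eval_linSubst])
  obtain ⟨N, hN, rfl⟩ := Finset.mem_image.mp hW
  exact ⟨N, hN, hwW⟩

end Surface

section EvalAeval

variable {k : Type*} [Field k] {σ τ : Type*}

theorem eval_aeval_eq (v : τ → k) (g : σ → MvPolynomial τ k) (p : MvPolynomial σ k) :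
    eval v (aeval g p) = eval (fun i => eval v (g i)) p := by
  simpa [aeval_eq_eval] using comp_aeval_apply (aeval v : MvPolynomial τ k →ₐ[k] k) (f := g) p

theorem polynomial_eval_aeval_eq (t : k) (g : σ → Polynomial k) (p : MvPolynomial σ k) :
    (aeval g p : Polynomial k).eval t = eval (fun i => (g i).eval t) p := by
  simpa [aeval_eq_eval] using comp_aeval_apply (Polynomial.aeval t : Polynomial k →ₐ[k] k)
    (f := g) p

theorem MvPolynomial.IsHomogeneous.eq_zero_of_dvd {p q : MvPolynomial σ k} {m n : ℕ}
    (hp : p.IsHomogeneous m) (hq : q.IsHomogeneous n) (h : p ∣ q) (hlt : n < m) : q = 0 := by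
  by_contra h0
  obtain ⟨c, rfl⟩ := h
  have hp0 := left_ne_zero_of_mul h0
  have := hq.totalDegree h0
  rw [totalDegree_mul_of_isDomain hp0 (right_ne_zero_of_mul h0), hp.totalDegree hp0] at this
  omega

end EvalAeval

section BinaryForms

variable {k : Type*} [Field k] [IsAlgClosed k]

theorem isHomogeneous_fin_two_eq_zero {p : MvPolynomial (Fin 2) k} {n : ℕ} (hp : p.IsHomogeneous n)
    (h : (aeval ![1, Polynomial.X] p : Polynomial k) = 0) : p = 0 := by
  have : X 0 * p = 0 := MvPolynomial.funext fun v => by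
    rcases eq_or_ne (v 0) 0 with h0 | h0
    · simp [h0]
    · have hv : v = v 0 • ![1, v 1 / v 0] := by
        ext i; fin_cases i
        · simp
        · simp [mul_div_cancel₀ _ h0]
      have h1 := polynomial_eval_aeval_eq (v 1 / v 0) ![1, Polynomial.X] p
      have h2 : (fun i => (![1, Polynomial.X] i : Polynomial k).eval (v 1 / v 0)) =
          ![1, v 1 / v 0] := by
        ext i; fin_cases i <;> simp
      rw [h, h2] at h1
      rw [hv, map_mul, hp.eval_smul, ← h1]
      simp
  exact (mul_eq_zero.mp this).resolve_left (X_ne_zero 0)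

/-- A pencil of binary forms of the same degree, without base points and not consisting of forms
with vanishing derivatives, has only finitely many members which have a multiple root. -/
theorem finite_setOf_exists_multiple_root {A B : MvPolynomial (Fin 2) k} {n : ℕ}
    (hA : A.IsHomogeneous n) (hB : B.IsHomogeneous n)
    (hbase : ∀ v : Fin 2 → k, v ≠ 0 → ¬ (eval v A = 0 ∧ eval v B = 0))
    (hder : ¬ ∀ i, pderiv i A = 0 ∧ pderiv i B = 0) :
    {τ : k | ∃ u, eval ![1, u] A + τ * eval ![1, u] B = 0 ∧
      eval ![1, u] (pderiv 1 A) + τ * eval ![1, u] (pderiv 1 B) = 0}.Finite := by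
  let r : MvPolynomial (Fin 2) k →ₐ[k] Polynomial k := aeval ![1, Polynomial.X]
  have hr : ∀ u p, (r p).eval u = eval ![1, u] p := fun u p => by
    rw [polynomial_eval_aeval_eq]
    congr 2
    ext i; fin_cases i <;> simp
  have hrd : ∀ p, Polynomial.derivative (r p) = r (pderiv 1 p) := fun p => by
    have := Derivation.apply_aeval (Polynomial.derivative' (R := k)) ![1, Polynomial.X] p
    simpa [Fin.sum_univ_two] using this
  have hcop : IsCoprime (r A) (r B) := by
    rw [Polynomial.isCoprime_iff_aeval_ne_zero_of_isAlgClosed k (k := k)]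
    intro u
    by_contra! hu
    simp only [Polynomial.coe_aeval_eq_eval, hr] at hu
    exact hbase ![1, u] (fun h => one_ne_zero (congrFun h 0)) hu
  have hW : r B * r (pderiv 1 A) - r A * r (pderiv 1 B) ≠ 0 := by
    intro h
    rw [sub_eq_zero, ← hrd, ← hrd] at h
    have h1 : Polynomial.derivative (r A) = 0 :=
      Polynomial.dvd_derivative_iff.mp (hcop.dvd_of_dvd_mul_left (Dvd.intro _ h.symm))
    have h2 : Polynomial.derivative (r B) = 0 :=
      Polynomial.dvd_derivative_iff.mp (hcop.symm.dvd_of_dvd_mul_left (Dvd.intro _ h))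
    rw [hrd] at h1 h2
    have hA1 := isHomogeneous_fin_two_eq_zero hA.pderiv h1
    have hB1 := isHomogeneous_fin_two_eq_zero hB.pderiv h2
    have eA := hA.sum_X_mul_pderiv
    have eB := hB.sum_X_mul_pderiv
    simp only [Fin.sum_univ_two, hA1, hB1, mul_zero, add_zero] at eA eB
    have hn : (n : k) = 0 := by
      by_contra hn
      refine hbase ![0, 1] (fun h => one_ne_zero (congrFun h 1)) ⟨?_, ?_⟩
      · simpa [hn] using (congrArg (eval ![0, 1]) eA).symm
      · simpa [hn] using (congrArg (eval ![0, 1]) eB).symm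
    have hn' : (n : MvPolynomial (Fin 2) k) = 0 := by
      rw [← map_natCast C, hn, C_0]
    rw [nsmul_eq_mul, hn', zero_mul] at eA eB
    refine hder fun i => ?_
    fin_cases i
    · exact ⟨(mul_eq_zero.mp eA).resolve_left (X_ne_zero 0),
        (mul_eq_zero.mp eB).resolve_left (X_ne_zero 0)⟩
    · exact ⟨hA1, hB1⟩
  refine (((r B * r (pderiv 1 A) - r A * r (pderiv 1 B)).rootSet_finite k).image
    fun u => -eval ![1, u] A / eval ![1, u] B).subset ?_
  rintro τ ⟨u, h1, h2⟩
  have hB0 : eval ![1, u] B ≠ 0 := fun h0 =>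
    hbase ![1, u] (fun h => one_ne_zero (congrFun h 0)) ⟨by simpa [h0] using h1, h0⟩
  refine ⟨u, ?_, ?_⟩
  · rw [Polynomial.mem_rootSet]
    refine ⟨hW, ?_⟩
    simp only [Polynomial.coe_aeval_eq_eval, Polynomial.eval_sub, Polynomial.eval_mul, hr]
    linear_combination eval ![1, u] B * h2 - eval ![1, u] (pderiv 1 B) * h1
  · rw [div_eq_iff hB0]
    linear_combination -h1

end BinaryForms

section TransversalForm

variable {k : Type*} [Field k]

/-- Restriction of polynomials to the line `x = y = 0`. -/
noncomputable def restrictLine (k : Type*) [Field k] :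
    MvPolynomial (Fin 4) k →ₐ[k] MvPolynomial (Fin 2) k :=
  aeval ![0, 0, X 0, X 1]

/-- Evaluation at the point of `x = y = 0` in which the tangent plane of a point of `V(f)`
meets that line. -/
noncomputable def tangentPointSubst (f : MvPolynomial (Fin 4) k) :
    MvPolynomial (Fin 4) k →ₐ[k] MvPolynomial (Fin 4) k :=
  aeval ![0, 0, pderiv 3 f, -pderiv 2 f]

/-- A form which vanishes on all lines of `V(f)` meeting the line `x = y = 0` of `V(f)`. -/
noncomputable def transversalForm (f : MvPolynomial (Fin 4) k) : MvPolynomial (Fin 4) k :=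
  X 0 * tangentPointSubst f (pderiv 0 f) + X 1 * tangentPointSubst f (pderiv 1 f)

theorem eval_restrictLine (v : Fin 2 → k) (p : MvPolynomial (Fin 4) k) :
    eval v (restrictLine k p) = eval ![0, 0, v 0, v 1] p := by
  rw [restrictLine, eval_aeval_eq]
  congr 2
  ext i; fin_cases i <;> simp

theorem isHomogeneous_restrictLine {p : MvPolynomial (Fin 4) k} {n : ℕ} (hp : p.IsHomogeneous n) :
    (restrictLine k p).IsHomogeneous n := by
  have := hp.aeval (![0, 0, X 0, X 1] : Fin 4 → MvPolynomial (Fin 2) k) (n := 1) fun i => by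
    fin_cases i
    · exact isHomogeneous_zero _ _ _
    · exact isHomogeneous_zero _ _ _
    · exact isHomogeneous_X _ _
    · exact isHomogeneous_X _ _
  rwa [one_mul] at this

theorem eval_tangentPointSubst (f : MvPolynomial (Fin 4) k) (q : Fin 4 → k)
    (p : MvPolynomial (Fin 4) k) : eval q (tangentPointSubst f p) =
      eval ![0, 0, eval q (pderiv 3 f), -eval q (pderiv 2 f)] p := by
  rw [tangentPointSubst, eval_aeval_eq]
  congr 2
  ext i; fin_cases i <;> simp

theorem tangentPointSubst_eq (f p : MvPolynomial (Fin 4) k) : tangentPointSubst f p =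
    aeval ![pderiv 3 f, -pderiv 2 f] (restrictLine k p) := by
  rw [tangentPointSubst, restrictLine, comp_aeval_apply]
  congr 2
  ext i; fin_cases i <;> simp

theorem gradientAt_fin_four (f : MvPolynomial (Fin 4) k) (q w : Fin 4 → k) :
    gradientAt f q w = eval q (pderiv 0 f) * w 0 + eval q (pderiv 1 f) * w 1 +
      eval q (pderiv 2 f) * w 2 + eval q (pderiv 3 f) * w 3 := by
  rw [gradientAt_apply, Fin.sum_univ_four]

/-- The line `x = y = 0`. -/
def axis (k : Type*) [Field k] : Submodule k (Fin 4 → k) :=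
  LinearMap.ker (LinearMap.proj 0) ⊓ LinearMap.ker (LinearMap.proj 1)

theorem mem_axis {v : Fin 4 → k} : v ∈ axis k ↔ v 0 = 0 ∧ v 1 = 0 := Iff.rfl

theorem eq_of_mem_axis {v : Fin 4 → k} (h : v ∈ axis k) : v = ![0, 0, v 2, v 3] := by
  ext i; fin_cases i
  · exact h.1
  · exact h.2
  · rfl
  · rfl

variable {f : MvPolynomial (Fin 4) k} {d : ℕ}

theorem pderiv_eq_zero_of_mem_axis [Infinite k] (hM : ∀ v ∈ axis k, eval v f = 0)
    {q : Fin 4 → k} (hq : q ∈ axis k) : eval q (pderiv 2 f) = 0 ∧ eval q (pderiv 3 f) = 0 := by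
  constructor
  · rw [← gradientAt_single]
    exact gradientAt_eq_zero_of_mem hM hq (by simp [mem_axis])
  · rw [← gradientAt_single]
    exact gradientAt_eq_zero_of_mem hM hq (by simp [mem_axis])

theorem IsSmoothSurface.pderiv_eq_zero_of_dvd (hf : IsSmoothSurface f d) (hd : 2 ≤ d) {i : Fin 4}
    (h : f ∣ pderiv i f) : pderiv i f = 0 :=
  hf.2.1.eq_zero_of_dvd hf.2.1.pderiv h (by omega)

variable [IsAlgClosed k]

theorem IsSmoothSurface.eq_zero_of_mem_axis (hf : IsSmoothSurface f d)
    (hM : ∀ v ∈ axis k, eval v f = 0) {q : Fin 4 → k} (hq : q ∈ axis k)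
    (h0 : eval q (pderiv 0 f) = 0) (h1 : eval q (pderiv 1 f) = 0) : q = 0 := by
  by_contra hne
  have := pderiv_eq_zero_of_mem_axis hM hq
  exact hf.2.2 q hne ⟨hM q hq, fun i => by fin_cases i; exacts [h0, h1, this.1, this.2]⟩

theorem IsSmoothSurface.pderiv_two_ne_zero_or (hf : IsSmoothSurface f d) (hd : 2 ≤ d) :
    pderiv 2 f ≠ 0 ∨ pderiv 3 f ≠ 0 := by
  classical
  by_contra! h
  obtain ⟨v, hv, hz⟩ := exists_ne_zero_forall_eval_eq_zero {f, pderiv 0 f, pderiv 1 f}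
    (Finset.card_le_three.trans_lt (by norm_num)) (by
      simp only [Finset.mem_insert, Finset.mem_singleton, forall_eq_or_imp, forall_eq]
      exact ⟨hf.2.1.eval_zero (by omega), hf.2.1.pderiv.eval_zero (by omega),
        hf.2.1.pderiv.eval_zero (by omega)⟩)
  simp only [Finset.mem_insert, Finset.mem_singleton, forall_eq_or_imp, forall_eq] at hz
  exact hf.2.2 v hv ⟨hz.1, fun i => by
    fin_cases i; exacts [hz.2.1, hz.2.2, by simp [h.1], by simp [h.2]]⟩

theorem IsSmoothSurface.exists_pderiv_restrictLine_ne_zero (hf : IsSmoothSurface f d) (hd : 2 ≤ d)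
    (hM : ∀ v ∈ axis k, eval v f = 0) (hG : f ∣ transversalForm f) :
    ¬ ∀ i, pderiv i (restrictLine k (pderiv 0 f)) = 0 ∧
      pderiv i (restrictLine k (pderiv 1 f)) = 0 := by
  intro hder
  have hprime := (hf.irreducible (by omega)).prime
  have hconst : ∀ i, pderiv i (tangentPointSubst f (pderiv 0 f)) = 0 ∧
      pderiv i (tangentPointSubst f (pderiv 1 f)) = 0 := fun i => by
    simp only [tangentPointSubst_eq, Derivation.apply_aeval, hder, map_zero, zero_mul,
      Finset.sum_const_zero, and_self]
  obtain ⟨u, hu⟩ := hG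
  have hdu : ∀ i, i ≠ 0 → i ≠ 1 → f ∣ u ∨ pderiv i f = 0 := by
    intro i h0 h1
    have h := congrArg (pderiv i) hu
    simp only [transversalForm, map_add, Derivation.leibniz, (hconst i).1, (hconst i).2,
      pderiv_X_of_ne h0.symm, pderiv_X_of_ne h1.symm, smul_zero, add_zero] at h
    have : f ∣ u * pderiv i f := ⟨-pderiv i u, by
      rw [smul_eq_mul, smul_eq_mul] at h; linear_combination -h⟩
    exact (hprime.dvd_or_dvd this).imp_right (hf.pderiv_eq_zero_of_dvd hd)
  have hfu : f ∣ u := by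
    rcases hdu 2 (by decide) (by decide) with h | h2
    · exact h
    rcases hdu 3 (by decide) (by decide) with h | h3
    · exact h
    exact absurd (hf.pderiv_two_ne_zero_or hd) (by simp [h2, h3])
  obtain ⟨u, rfl⟩ := hfu
  have hA : f ∣ tangentPointSubst f (pderiv 0 f) := by
    have h := congrArg (pderiv 0) hu
    simp only [transversalForm, map_add, Derivation.leibniz, (hconst 0).1, (hconst 0).2,
      pderiv_X_self, pderiv_X_of_ne (show (1 : Fin 4) ≠ 0 by decide), add_zero,
      zero_add, smul_eq_mul, mul_one, mul_zero] at h
    rw [h]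
    exact ⟨f * pderiv 0 u + u * pderiv 0 f + u * pderiv 0 f, by ring⟩
  have hB : f ∣ tangentPointSubst f (pderiv 1 f) := by
    have h := congrArg (pderiv 1) hu
    simp only [transversalForm, map_add, Derivation.leibniz, (hconst 1).1, (hconst 1).2,
      pderiv_X_self, pderiv_X_of_ne (show (0 : Fin 4) ≠ 1 by decide), add_zero,
      zero_add, smul_eq_mul, mul_one, mul_zero] at h
    rw [h]
    exact ⟨f * pderiv 1 u + u * pderiv 1 f + u * pderiv 1 f, by ring⟩
  have hvan : ∀ q, eval q f = 0 → eval q (pderiv 2 f) = 0 ∧ eval q (pderiv 3 f) = 0 := by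
    intro q hq
    have h0 := zero_dvd_iff.mp (hq ▸ map_dvd (eval q) hA)
    have h1 := zero_dvd_iff.mp (hq ▸ map_dvd (eval q) hB)
    rw [eval_tangentPointSubst] at h0 h1
    have := hf.eq_zero_of_mem_axis hM (mem_axis.mpr ⟨rfl, rfl⟩) h0 h1
    exact ⟨neg_eq_zero.mp (congrFun this 3), congrFun this 2⟩
  have hirr := hf.irreducible (by omega)
  have h2 := hf.pderiv_eq_zero_of_dvd hd
    (hirr.dvd_of_forall_eval_eq_zero fun q hq => (hvan q hq).1)
  have h3 := hf.pderiv_eq_zero_of_dvd hd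
    (hirr.dvd_of_forall_eval_eq_zero fun q hq => (hvan q hq).2)
  exact absurd (hf.pderiv_two_ne_zero_or hd) (by simp [h2, h3])

end TransversalForm

section TernaryForms

variable {k : Type*} [Field k]

theorem MvPolynomial.IsHomogeneous.eval_eq_gradientAt {σ : Type*} [Fintype σ]
    {p : MvPolynomial σ k} (h : p.IsHomogeneous 1) (v : σ → k) :
    eval v p = gradientAt p 0 v := by
  have h1 := congrArg (eval v) h.sum_X_mul_pderiv
  have h0 : ∀ i, eval v (pderiv i p) = eval 0 (pderiv i p) := fun i => by
    have := (h.pderiv (i := i)).eval_smul 0 v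
    simpa using this.symm
  rw [gradientAt_apply]
  simpa [h0, mul_comm] using h1.symm

/-- The restriction of ternary polynomials to the affine line `(0, 1, u)`. -/
noncomputable def affineRestrict (k : Type*) [Field k] :
    MvPolynomial (Fin 3) k →ₐ[k] Polynomial k :=
  aeval ![0, 1, Polynomial.X]

theorem eval_affineRestrict (u : k) (p : MvPolynomial (Fin 3) k) :
    (affineRestrict k p).eval u = eval ![0, 1, u] p := by
  rw [affineRestrict, polynomial_eval_aeval_eq]
  congr 2
  ext i; fin_cases i <;> simp

theorem derivative_affineRestrict (p : MvPolynomial (Fin 3) k) :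
    (affineRestrict k p).derivative = affineRestrict k (pderiv 2 p) := by
  have := Derivation.apply_aeval (Polynomial.derivative' (R := k)) ![0, 1, Polynomial.X] p
  simpa [Fin.sum_univ_three, affineRestrict] using this

theorem coeff_affineRestrict {p : MvPolynomial (Fin 3) k} {n : ℕ} (hp : p.IsHomogeneous n) :
    (affineRestrict k p).coeff n = eval ![0, 0, 1] p := by
  rw [affineRestrict, aeval_def, eval₂_eq', eval_eq', Polynomial.finsetSum_coeff]
  refine Finset.sum_congr rfl fun m hm => ?_
  have hdeg := hp (mem_support_iff.mp hm)
  rw [Finsupp.weight_apply, Finsupp.sum_fintype _ _ (by simp)] at hdeg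
  simp only [Pi.one_apply, smul_eq_mul, mul_one, Fin.sum_univ_three] at hdeg
  simp only [Fin.prod_univ_three, Polynomial.algebraMap_eq, Polynomial.coeff_C_mul,
    Matrix.cons_val_zero, Matrix.cons_val_one, Matrix.cons_val, one_pow, mul_one]
  congr 1
  rcases eq_or_ne (m 0) 0 with h0 | h0
  · rcases eq_or_ne (m 1) 0 with h1 | h1
    · simp [h0, h1, Polynomial.coeff_X_pow, ← hdeg]
    · simp [h0, h1, Polynomial.coeff_X_pow, ← hdeg]
  · simp [h0]

theorem exists_add_algebraMap_mul_eq_zero [IsAlgClosed k] {K : Type*} [Field K] [Algebra k K]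
    {g : MvPolynomial (Fin 3) k} {n : ℕ} (hg : g.IsHomogeneous n) (hg1 : eval ![0, 0, 1] g ≠ 0)
    {p q : K} (h : aeval ![0, p, -q] g = 0) : ∃ c : k, q + algebraMap k K c * p = 0 := by
  rcases eq_or_ne p 0 with rfl | hp
  · have h1 : (![0, 0, -q] : Fin 3 → K) = (-q) • ((algebraMap k K) ∘ ![0, 0, 1]) := by
      ext i; fin_cases i <;> simp
    rw [h1, hg.aeval_smul, aeval_algebraMap_apply, aeval_eq_eval] at h
    have := eq_zero_of_pow_eq_zero ((mul_eq_zero.mp h).resolve_right (by simpa using hg1))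
    exact ⟨0, by simpa using this⟩
  · have h1 : (![0, p, -q] : Fin 3 → K) = p • ![0, 1, -q / p] := by
      ext i; fin_cases i <;> simp [mul_div_cancel₀ _ hp]
    rw [h1, hg.aeval_smul] at h
    have h2 : Polynomial.aeval (-q / p) (affineRestrict k g) = 0 := by
      have h3 : (fun i => Polynomial.aeval (-q / p)
          ((![0, 1, Polynomial.X] : Fin 3 → Polynomial k) i)) =
          ![0, 1, -q / p] := by
        ext i; fin_cases i <;> simp
      rw [affineRestrict, comp_aeval_apply, h3]
      exact (mul_eq_zero.mp h).resolve_left (pow_ne_zero _ hp)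
    have hne : affineRestrict k g ≠ 0 := fun h0 => hg1 (by
      rw [← coeff_affineRestrict hg, h0, Polynomial.coeff_zero])
    have hint : IsIntegral k (-q / p) := IsAlgebraic.isIntegral ⟨_, hne, h2⟩
    obtain ⟨c, hc⟩ := minpoly.mem_range_of_degree_eq_one k _
      (IsAlgClosed.degree_eq_one_of_irreducible k (minpoly.irreducible hint))
    refine ⟨c, ?_⟩
    rw [hc]
    field_simp
    ring

theorem Prime.exists_dvd_add_C_mul [IsAlgClosed k] {g h p q : MvPolynomial (Fin 3) k} {n : ℕ}
    (hh : Prime h) (hg : g.IsHomogeneous n) (hg1 : eval ![0, 0, 1] g ≠ 0)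
    (hdvd : h ∣ aeval ![0, p, -q] g) : ∃ c : k, h ∣ q + C c * p := by
  let I := Ideal.span {h}
  have : I.IsPrime := (Ideal.span_singleton_prime hh.ne_zero).mpr hh
  let φ : MvPolynomial (Fin 3) k →ₐ[k] FractionRing (MvPolynomial (Fin 3) k ⧸ I) :=
    (IsScalarTower.toAlgHom k (MvPolynomial (Fin 3) k ⧸ I) _).comp (Ideal.Quotient.mkₐ k I)
  have hφ : ∀ r, φ r = 0 ↔ h ∣ r := fun r => by
    simp only [φ, AlgHom.comp_apply, IsScalarTower.coe_toAlgHom', Ideal.Quotient.mkₐ_eq_mk,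
      FaithfulSMul.algebraMap_eq_zero_iff, Ideal.Quotient.eq_zero_iff_dvd, I]
  obtain ⟨c, hc⟩ := exists_add_algebraMap_mul_eq_zero hg hg1 (p := φ p) (q := φ q) (by
    have h1 : (fun i => φ ((![0, p, -q] : Fin 3 → MvPolynomial (Fin 3) k) i)) =
        ![0, φ p, -φ q] := by
      ext i; fin_cases i <;> simp
    rw [← h1, ← comp_aeval_apply]
    exact (hφ _).mpr hdvd)
  refine ⟨c, (hφ _).mp ?_⟩
  rw [← hc, map_add, map_mul, ← algebraMap_eq, AlgHom.commutes]

/-- If a plane curve meets the line `x₀ = 0` transversally and its tangent lines meet it only in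
points of the curve, then the curve contains a line. -/
theorem exists_linear_form_dvd [IsAlgClosed k] {g : MvPolynomial (Fin 3) k} {n m : ℕ} (hn : n ≠ 0)
    (hg : g.IsHomogeneous n) (hg1 : eval ![0, 0, 1] g ≠ 0)
    (hsimple : ∀ u, eval ![0, 1, u] g = 0 → eval ![0, 1, u] (pderiv 2 g) ≠ 0)
    (hdvd : g ∣ X 0 ^ m * aeval ![0, pderiv 2 g, -pderiv 1 g] g) :
    ∃ h : MvPolynomial (Fin 3) k, h.IsHomogeneous 1 ∧ eval ![0, 0, 1] h ≠ 0 ∧ h ∣ g := by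
  classical
  have hg0 : g ≠ 0 := by rintro rfl; simp at hg1
  obtain ⟨h, hirr, q, rfl⟩ := WfDvdMonoid.exists_irreducible_factor (a := g)
    (fun hu => (hu.map (eval 0)).ne_zero (hg.eval_zero hn)) hg0
  obtain ⟨a, b, -, hh, -⟩ := IsHomogeneous.exists_of_mul hg hg0
  have hh1 : eval ![0, 0, 1] h ≠ 0 := fun h0 => hg1 (by rw [map_mul, h0, zero_mul])
  have hX : ¬ h ∣ X 0 := fun hd => hh1 (by
    obtain ⟨c, hc⟩ := (hirr.associated_of_dvd X_prime.irreducible hd).symm.dvd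
    simp [hc])
  obtain ⟨c, hc⟩ := hirr.prime.exists_dvd_add_C_mul hg hg1
    ((hirr.prime.dvd_or_dvd ((dvd_mul_right h q).trans hdvd)).resolve_left
      fun hd => hX (hirr.prime.dvd_of_dvd_pow hd))
  have ha : a ≠ 0 := by
    rintro rfl
    exact hirr.not_isUnit (hh.isUnit_of_ne_zero hirr.ne_zero)
  have hne : affineRestrict k h ≠ 0 := fun h0 => hh1 (by
    rw [← coeff_affineRestrict hh, h0, Polynomial.coeff_zero])
  have hdeg : a ≤ (affineRestrict k h).natDegree :=
    Polynomial.le_natDegree_of_ne_zero (by rwa [coeff_affineRestrict hh])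
  have hderiv : ∀ u, eval ![0, 1, u] h = 0 →
      eval ![0, 1, u] (pderiv 2 h) ≠ 0 ∧ eval ![0, 1, u] q ≠ 0 := fun u hu => by
    have := hsimple u (by simp [hu])
    simp only [Derivation.leibniz, smul_eq_mul, map_add, map_mul, hu, zero_mul, zero_add] at this
    exact ⟨right_ne_zero_of_mul this, left_ne_zero_of_mul this⟩
  have hq : ¬ h ∣ q := fun hd => by
    obtain ⟨u, hu⟩ := IsAlgClosed.exists_root (affineRestrict k h) (fun h0 => by
      have := Polynomial.natDegree_eq_zero_iff_degree_le_zero.mpr h0.le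
      omega)
    rw [Polynomial.IsRoot, eval_affineRestrict] at hu
    obtain ⟨c, rfl⟩ := hd
    exact (hderiv u hu).2 (by simp [hu])
  have hflat : pderiv 1 h + C c * pderiv 2 h = 0 := by
    refine hh.eq_zero_of_dvd (n := a - 1) (hh.pderiv.add (hh.pderiv.C_mul c)) ?_ (by omega)
    refine (hirr.prime.dvd_or_dvd (a := q) ?_).resolve_left hq
    obtain ⟨r, hr⟩ := hc
    refine ⟨r - pderiv 1 q - C c * pderiv 2 q, ?_⟩
    simp only [Derivation.leibniz, smul_eq_mul] at hr
    linear_combination hr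
  have hroot : ∀ u ∈ (affineRestrict k h).roots, u = c := fun u hu => by
    rw [Polynomial.mem_roots hne, Polynomial.IsRoot, eval_affineRestrict] at hu
    have h1 := congrArg (eval ![0, 1, u]) hh.sum_X_mul_pderiv
    have h2 := congrArg (eval ![0, 1, u]) hflat
    simp only [Fin.sum_univ_three, map_add, map_mul, eval_X, eval_C, map_zero, map_nsmul, hu,
      Matrix.cons_val_zero, Matrix.cons_val_one, Matrix.cons_val, smul_zero] at h1 h2
    have h3 : (u - c) * eval ![0, 1, u] (pderiv 2 h) = 0 := by linear_combination h1 - h2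
    exact sub_eq_zero.mp ((mul_eq_zero.mp h3).resolve_right (hderiv u hu).1)
  have hnodup : (affineRestrict k h).roots.Nodup := Multiset.nodup_iff_count_le_one.mpr fun u => by
    rw [Polynomial.count_roots]
    by_contra! hlt
    obtain ⟨h1, h2⟩ := (Polynomial.one_lt_rootMultiplicity_iff_isRoot hne).mp hlt
    rw [derivative_affineRestrict] at h2
    rw [Polynomial.IsRoot, eval_affineRestrict] at h1 h2
    exact (hderiv u h1).1 h2
  have hcard : (affineRestrict k h).roots.card ≤ 1 :=
    Multiset.card_le_card (t := {c}) ((Multiset.le_iff_subset hnodup).mpr fun u hu => by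
      simpa using hroot u hu)
  rw [← (IsAlgClosed.splits (affineRestrict k h)).natDegree_eq_card_roots] at hcard
  obtain rfl : a = 1 := by omega
  exact ⟨h, hh, hh1, dvd_mul_right h q⟩

end TernaryForms

section PlaneSection

variable {k : Type*} [Field k]

/-- Restriction of polynomials to the plane `y = τ x`. -/
noncomputable def planeRestrict (τ : k) : MvPolynomial (Fin 4) k →ₐ[k] MvPolynomial (Fin 3) k :=
  aeval ![X 0, C τ * X 0, X 1, X 2]

theorem eval_planeRestrict (τ : k) (v : Fin 3 → k) (p : MvPolynomial (Fin 4) k) :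
    eval v (planeRestrict τ p) = eval ![v 0, τ * v 0, v 1, v 2] p := by
  rw [planeRestrict, eval_aeval_eq]
  congr 2
  ext i; fin_cases i <;> simp

theorem isHomogeneous_planeRestrict (τ : k) {p : MvPolynomial (Fin 4) k} {n : ℕ}
    (hp : p.IsHomogeneous n) : (planeRestrict τ p).IsHomogeneous n := by
  have := hp.aeval (![X 0, C τ * X 0, X 1, X 2] : Fin 4 → MvPolynomial (Fin 3) k) (n := 1)
    fun i => by
      fin_cases i
      · exact isHomogeneous_X _ _
      · exact (isHomogeneous_X _ _).C_mul _
      · exact isHomogeneous_X _ _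
      · exact isHomogeneous_X _ _
  rwa [one_mul] at this

theorem pderiv_planeRestrict (τ : k) (p : MvPolynomial (Fin 4) k) :
    pderiv 0 (planeRestrict τ p) =
        planeRestrict τ (pderiv 0 p) + C τ * planeRestrict τ (pderiv 1 p) ∧
      pderiv 1 (planeRestrict τ p) = planeRestrict τ (pderiv 2 p) ∧
      pderiv 2 (planeRestrict τ p) = planeRestrict τ (pderiv 3 p) := by
  refine ⟨?_, ?_, ?_⟩ <;>
  · rw [planeRestrict, Derivation.apply_aeval, Fin.sum_univ_four]
    simp [-aeval_eq_bind₁, pderiv_X, mul_comm]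

variable {f : MvPolynomial (Fin 4) k} {d : ℕ} {τ : k} {g : MvPolynomial (Fin 3) k}

theorem aeval_eq_restrictLine_add (hg : planeRestrict τ f = X 0 * g) :
    aeval ![0, X 0, X 1] g =
      restrictLine k (pderiv 0 f) + C τ * restrictLine k (pderiv 1 f) := by
  have h : ∀ p, (aeval ![0, X 0, X 1] (planeRestrict τ p) : MvPolynomial (Fin 2) k) =
      restrictLine k p := fun p => by
    rw [planeRestrict, restrictLine, comp_aeval_apply]
    congr 2
    ext i; fin_cases i <;> simp
  have h1 := congrArg (aeval (![0, X 0, X 1] : Fin 3 → MvPolynomial (Fin 2) k))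
    (pderiv_planeRestrict τ f).1
  rw [hg] at h1
  simpa [-aeval_eq_bind₁, h] using h1

theorem dvd_of_dvd_transversalForm (hf : f.IsHomogeneous d) (hg : planeRestrict τ f = X 0 * g)
    (hG : f ∣ transversalForm f) :
    g ∣ X 0 ^ (d - 1) * aeval ![0, pderiv 2 g, -pderiv 1 g] g := by
  have h2 : planeRestrict τ (pderiv 2 f) = X 0 * pderiv 1 g := by
    rw [← (pderiv_planeRestrict τ f).2.1, hg]
    simp
  have h3 : planeRestrict τ (pderiv 3 f) = X 0 * pderiv 2 g := by
    rw [← (pderiv_planeRestrict τ f).2.2, hg]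
    simp
  have h4 : ∀ i, planeRestrict τ (tangentPointSubst f (pderiv i f)) =
      X 0 ^ (d - 1) * aeval ![pderiv 2 g, -pderiv 1 g] (restrictLine k (pderiv i f)) := fun i => by
    rw [tangentPointSubst_eq, comp_aeval_apply,
      ← (isHomogeneous_restrictLine hf.pderiv).aeval_smul]
    congr 2
    ext1 i; fin_cases i <;> simp [h2, h3]
  have h5 : aeval ![0, pderiv 2 g, -pderiv 1 g] g = aeval ![pderiv 2 g, -pderiv 1 g]
      (aeval ![0, X 0, X 1] g : MvPolynomial (Fin 2) k) := by
    rw [comp_aeval_apply]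
    congr 2
    ext1 i; fin_cases i <;> simp
  have h := map_dvd (planeRestrict τ) hG
  rw [transversalForm, map_add, map_mul, map_mul, h4, h4, hg] at h
  rw [h5, aeval_eq_restrictLine_add hg, map_add, map_mul, aeval_C, algebraMap_eq]
  refine (mul_dvd_mul_iff_left (X_ne_zero (R := k) (0 : Fin 3))).mp (h.trans (dvd_of_eq ?_))
  simp only [planeRestrict, aeval_X, Matrix.cons_val_zero, Matrix.cons_val_one]
  ring

theorem exists_isLineOn_of_linear_form {h : MvPolynomial (Fin 3) k} (hh : h.IsHomogeneous 1)
    (h1 : eval ![0, 0, 1] h ≠ 0) (hdvd : h ∣ planeRestrict τ f) :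
    ∃ N, IsLineOn f N ∧ (∃ v ∈ N, v 0 = 1) ∧ ∀ v ∈ N, v 1 = τ * v 0 := by
  obtain ⟨a, b, c, hc⟩ : ∃ a b c, ∀ w, eval w h = a * w 0 + b * w 1 + c * w 2 :=
    ⟨_, _, _, fun w => by
      rw [hh.eval_eq_gradientAt, gradientAt_apply, Fin.sum_univ_three]⟩
  have hc0 : c ≠ 0 := by simpa [hc] using h1
  let B : (Fin 2 → k) →ₗ[k] (Fin 4 → k) := LinearMap.pi ![LinearMap.proj 0, τ • LinearMap.proj 0,
    LinearMap.proj 1, (-a / c) • LinearMap.proj 0 + (-b / c) • LinearMap.proj 1]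
  have hB : ∀ v, B v = ![v 0, τ * v 0, v 1, -a / c * v 0 + -b / c * v 1] := fun v => by
    ext i; fin_cases i <;> simp [B]
  refine ⟨LinearMap.range B, ⟨?_, ?_⟩, ⟨_, ⟨![1, 0], rfl⟩, by simp [hB]⟩, ?_⟩
  · rw [LinearMap.finrank_range_of_inj, Module.finrank_fin_fun]
    intro v w hvw
    rw [hB, hB] at hvw
    ext i; fin_cases i
    · simpa using congrFun hvw 0
    · simpa using congrFun hvw 2
  · rintro _ ⟨v, rfl⟩
    obtain ⟨q, hq⟩ := hdvd
    have h2 := eval_planeRestrict τ ![v 0, v 1, -a / c * v 0 + -b / c * v 1] f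
    rw [hq, map_mul, hc] at h2
    simp only [Matrix.cons_val_zero, Matrix.cons_val_one, Matrix.cons_val] at h2
    rw [hB, ← h2, mul_eq_zero]
    left
    field_simp
    ring
  · rintro _ ⟨v, rfl⟩
    simp [hB]

theorem IsSmoothSurface.not_dvd_transversalForm [IsAlgClosed k] (hf : IsSmoothSurface f d)
    (hd : 2 ≤ d) (hM : ∀ v ∈ axis k, eval v f = 0) (hfin : {W | IsLineOn f W}.Finite) :
    ¬ f ∣ transversalForm f := by
  intro hG
  have hbase : ∀ v : Fin 2 → k, v ≠ 0 → ¬ (eval v (restrictLine k (pderiv 0 f)) = 0 ∧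
      eval v (restrictLine k (pderiv 1 f)) = 0) := fun v hv h => hv (by
    rw [eval_restrictLine, eval_restrictLine] at h
    have := hf.eq_zero_of_mem_axis hM (mem_axis.mpr ⟨rfl, rfl⟩) h.1 h.2
    ext i; fin_cases i
    · exact congrFun this 2
    · exact congrFun this 3)
  have hfin1 := finite_setOf_exists_multiple_root
    (isHomogeneous_restrictLine (hf.2.1.pderiv (i := 0)))
    (isHomogeneous_restrictLine (hf.2.1.pderiv (i := 1))) hbase
    (hf.exists_pderiv_restrictLine_ne_zero hd hM hG)
  have hfin2 : {τ : k | ∃ N, IsLineOn f N ∧ (∃ v ∈ N, v 0 = 1) ∧ ∀ v ∈ N, v 1 = τ * v 0}.Finite :=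
    (hfin.biUnion (t := fun N => {τ : k | (∃ v ∈ N, v 0 = 1) ∧ ∀ v ∈ N, v 1 = τ * v 0})
      fun N _ => Set.Subsingleton.finite fun τ ⟨⟨v, hv, hv1⟩, hτ⟩ τ' ⟨_, hτ'⟩ => by
        have h1 := hτ v hv
        have h2 := hτ' v hv
        rw [hv1, mul_one] at h1 h2
        exact h1.symm.trans h2).subset fun τ ⟨N, hN, h⟩ => Set.mem_biUnion hN h
  have hfin3 : {τ : k | eval ![0, 1] (restrictLine k (pderiv 0 f)) +
      τ * eval ![0, 1] (restrictLine k (pderiv 1 f)) = 0}.Finite :=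
    Set.Subsingleton.finite fun τ hτ τ' hτ' => by
      rw [Set.mem_ofPred_eq] at hτ hτ'
      have h1 : (τ - τ') * eval ![0, 1] (restrictLine k (pderiv 1 f)) = 0 := by
        linear_combination hτ - hτ'
      refine sub_eq_zero.mp ((mul_eq_zero.mp h1).resolve_right fun h2 => ?_)
      exact hbase ![0, 1] (fun h0 => by simpa using congrFun h0 1) ⟨by simpa [h2] using hτ, h2⟩
  obtain ⟨τ, hτ⟩ := ((hfin1.union hfin2).union hfin3).infinite_compl.nonempty
  simp only [Set.mem_compl_iff, Set.mem_union, not_or] at hτ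
  obtain ⟨⟨hτ1, hτ2⟩, hτ3⟩ := hτ
  obtain ⟨g, hg⟩ : X 0 ∣ planeRestrict τ f :=
    X_prime.irreducible.dvd_of_forall_eval_eq_zero fun v hv => by
      rw [eval_planeRestrict]
      rw [eval_X] at hv
      exact hM _ (by simp [mem_axis, hv])
  have hρ := aeval_eq_restrictLine_add hg
  have hρe : ∀ v p, eval v (aeval ![0, X 0, X 1] p : MvPolynomial (Fin 2) k) =
      eval ![0, v 0, v 1] p := fun v p => by
    rw [eval_aeval_eq]
    congr 2
    ext i; fin_cases i <;> simp
  have hg1 : eval ![0, 0, 1] g ≠ 0 := fun h => hτ3 (by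
    have := congrArg (eval ![0, 1]) hρ
    rw [hρe] at this
    simpa [h] using this.symm)
  have hgne : X 0 * g ≠ 0 := mul_ne_zero (X_ne_zero _) (by rintro rfl; simp at hg1)
  have hghom : g.IsHomogeneous (d - 1) := by
    obtain ⟨a, b, hab, ha, hb⟩ :=
      IsHomogeneous.exists_of_mul (hg ▸ isHomogeneous_planeRestrict τ hf.2.1) hgne
    obtain rfl := ha.inj_right (isHomogeneous_X k 0) (X_ne_zero _)
    rwa [← hab, Nat.add_sub_cancel_left]
  have hρd : (aeval ![0, X 0, X 1] (pderiv 2 g) : MvPolynomial (Fin 2) k) =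
      pderiv 1 (restrictLine k (pderiv 0 f)) + C τ * pderiv 1 (restrictLine k (pderiv 1 f)) := by
    have := congrArg (pderiv 1) hρ
    rw [Derivation.apply_aeval, Fin.sum_univ_three] at this
    simpa [-aeval_eq_bind₁, pderiv_X_of_ne] using this
  obtain ⟨h, hh, hh1, hdvd⟩ := exists_linear_form_dvd (by omega) hghom hg1 (fun u hu hu2 => hτ1
    ⟨u, by
      have := congrArg (eval ![1, u]) hρ
      rw [hρe] at this
      simpa [hu] using this.symm, by
      have := congrArg (eval ![1, u]) hρd
      rw [hρe] at this
      simpa [hu2] using this.symm⟩) (dvd_of_dvd_transversalForm hf.2.1 hg hG)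
  exact hτ2 (exists_isLineOn_of_linear_form hh hh1 (hdvd.trans (hg ▸ dvd_mul_left g _)))

end PlaneSection

section TransversalForm

variable {k : Type*} [Field k] {f : MvPolynomial (Fin 4) k} {d : ℕ}

theorem isHomogeneous_transversalForm (hf : f.IsHomogeneous d) :
    (transversalForm f).IsHomogeneous ((d - 1) ^ 2 + 1) := by
  have h : ∀ i, (tangentPointSubst f (pderiv i f)).IsHomogeneous ((d - 1) * (d - 1)) := fun i =>
    hf.pderiv.aeval _ fun j => by
      fin_cases j
      · exact isHomogeneous_zero _ _ _
      · exact isHomogeneous_zero _ _ _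
      · exact hf.pderiv
      · exact hf.pderiv.neg
  rw [sq, add_comm]
  exact ((isHomogeneous_X _ _).mul (h 0)).add ((isHomogeneous_X _ _).mul (h 1))

theorem eval_transversalForm_eq_zero [Infinite k] (hf : f.IsHomogeneous d)
    (hM : ∀ v ∈ axis k, eval v f = 0) {N : Submodule k (Fin 4 → k)} (hN : ∀ v ∈ N, eval v f = 0)
    {p q : Fin 4 → k} (hp : p ∈ axis k) (hp0 : p ≠ 0) (hpN : p ∈ N) (hq : q ∈ N) :
    eval q (transversalForm f) = 0 := by
  have h1 := gradientAt_eq_zero_of_mem hN hq hpN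
  have h2 := gradientAt_eq_zero_of_mem hN hpN hq
  have h3 := pderiv_eq_zero_of_mem_axis hM hp
  have hp' := mem_axis.mp hp
  simp only [gradientAt_fin_four, hp'.1, hp'.2, h3.1, h3.2, mul_zero, zero_add, zero_mul,
    add_zero] at h1 h2
  obtain ⟨c, hc⟩ : ∃ c : k, ![0, 0, eval q (pderiv 3 f), -eval q (pderiv 2 f)] = c • p := by
    have hp2 := eq_of_mem_axis hp
    rcases eq_or_ne (p 2) 0 with h | h
    · have h' : p 3 ≠ 0 := fun h' => hp0 (by rw [hp2, h, h']; ext i; fin_cases i <;> rfl)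
      refine ⟨-eval q (pderiv 2 f) / p 3, ?_⟩
      rw [h, mul_zero, zero_add] at h1
      ext i; fin_cases i
      · simp [hp'.1]
      · simp [hp'.2]
      · simpa [h] using (mul_eq_zero.mp h1).resolve_right h'
      · simp [h']
    · refine ⟨eval q (pderiv 3 f) / p 2, ?_⟩
      ext i; fin_cases i
      · simp [hp'.1]
      · simp [hp'.2]
      · simp [h]
      · simp
        field_simp
        linear_combination -h1
  rw [transversalForm, map_add, map_mul, map_mul, eval_tangentPointSubst, eval_tangentPointSubst,
    hc, hf.pderiv.eval_smul, hf.pderiv.eval_smul, eval_X, eval_X]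
  linear_combination c ^ (d - 1) * h2

end TransversalForm

section GenericFibre

theorem Prime.isRelPrime_algebraMap {B B' : Type*} [CommRing B] [IsDomain B] [CommRing B']
    [Algebra B B'] (S : Submonoid B) [IsLocalization S B'] (hS : S ≤ nonZeroDivisors B) {f g : B}
    (hf : Prime f) (hfg : ¬ f ∣ g) : IsRelPrime (algebraMap B B' f) (algebraMap B B' g) := by
  have hinj := IsLocalization.injective B' hS
  have hunit : ∀ s ∈ S, IsUnit (algebraMap B B' s) := fun s hs =>
    IsLocalization.map_units B' (⟨s, hs⟩ : S)
  intro h ⟨u, hu⟩ ⟨v, hv⟩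
  obtain ⟨⟨h', a⟩, ha⟩ := IsLocalization.surj S h
  obtain ⟨⟨u', b⟩, hb⟩ := IsLocalization.surj S u
  obtain ⟨⟨v', c⟩, hc⟩ := IsLocalization.surj S v
  dsimp only at ha hb hc
  suffices IsUnit (algebraMap B B' h') from isUnit_of_mul_isUnit_left (ha ▸ this)
  have h1 : h' * u' = a * b * f := hinj (by
    rw [map_mul, map_mul, map_mul, hu, ← ha, ← hb]; ring)
  have h2 : h' * v' = a * c * g := hinj (by
    rw [map_mul, map_mul, map_mul, hv, ← ha, ← hc]; ring)
  rcases hf.dvd_or_dvd (Dvd.intro_left _ h1.symm) with ⟨s, rfl⟩ | ⟨s, rfl⟩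
  · rcases hf.dvd_or_dvd (a := (a * c : B)) (b := g) ⟨s * v', by rw [← h2]; ring⟩ with h3 | h3
    · have h4 := isUnit_of_dvd_unit (map_dvd (algebraMap B B') h3) (hunit _ (a * c).2)
      have h5 : s * u' = (a * b : B) := mul_right_cancel₀ hf.ne_zero (by rw [← h1]; ring)
      have h6 := isUnit_of_dvd_unit (map_dvd (algebraMap B B') (Dvd.intro _ h5))
        (hunit _ (a * b).2)
      rw [map_mul]
      exact h4.mul h6
    · exact absurd h3 hfg
  · have h5 : h' * s = (a * b : B) := mul_right_cancel₀ hf.ne_zero (by rw [← h1]; ring)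
    exact isUnit_of_dvd_unit (map_dvd (algebraMap B B') (Dvd.intro _ h5)) (hunit _ (a * b).2)

variable (k : Type*) [Field k]

/-- The field of rational functions in two variables. -/
abbrev BinaryFunctionField := FractionRing (MvPolynomial (Fin 2) k)

/-- Polynomials in `x, y, z, w` as polynomials in `y, z` over the field `k(x, w)`. -/
noncomputable def genericFibre :
    MvPolynomial (Fin 4) k →ₐ[k] MvPolynomial (Fin 2) (BinaryFunctionField k) :=
  aeval ![C (algebraMap (MvPolynomial (Fin 2) k) _ (X 0)), X 0, X 1,
    C (algebraMap (MvPolynomial (Fin 2) k) _ (X 1))]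

/-- Polynomials in `x, y, z, w` as polynomials in `y, z` over `k[x, w]`. -/
noncomputable def innerOuterEquiv :
    MvPolynomial (Fin 4) k ≃ₐ[k] MvPolynomial (Fin 2) (MvPolynomial (Fin 2) k) :=
  (renameEquiv k (⟨![.inr 0, .inl 0, .inl 1, .inr 1], Sum.elim ![1, 2] ![0, 3], by decide,
    by decide⟩ : Fin 4 ≃ Fin 2 ⊕ Fin 2)).trans (sumAlgEquiv k (Fin 2) (Fin 2))

theorem genericFibre_apply (p : MvPolynomial (Fin 4) k) :
    genericFibre k p = map (algebraMap _ _) (innerOuterEquiv k p) := by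
  have : (genericFibre k).toRingHom =
      (map (algebraMap _ _)).comp (innerOuterEquiv k).toAlgHom.toRingHom := by
    ext i
    · simp [genericFibre, innerOuterEquiv]
      rw [IsScalarTower.algebraMap_apply k (MvPolynomial (Fin 2) k), algebraMap_eq]
    · fin_cases i <;> simp [genericFibre, innerOuterEquiv]
  exact congrArg (fun φ => φ p) this

variable {k}

theorem genericFibre_injective : Function.Injective (genericFibre k) := fun p q h => by
  rw [genericFibre_apply, genericFibre_apply] at h
  exact (innerOuterEquiv k).injective (map_injective _ (IsFractionRing.injective _ _) h)

theorem Prime.isRelPrime_genericFibre {f g : MvPolynomial (Fin 4) k} (hf : Prime f)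
    (hfg : ¬ f ∣ g) : IsRelPrime (genericFibre k f) (genericFibre k g) := by
  let := algebraMvPolynomial (R := MvPolynomial (Fin 2) k) (S := BinaryFunctionField k)
    (σ := Fin 2)
  have hS : Submonoid.map C (nonZeroDivisors (MvPolynomial (Fin 2) k)) ≤
      nonZeroDivisors (MvPolynomial (Fin 2) (MvPolynomial (Fin 2) k)) := by
    rintro _ ⟨a, ha, rfl⟩
    exact mem_nonZeroDivisors_of_ne_zero (by simpa using nonZeroDivisors.ne_zero ha)
  rw [genericFibre_apply, genericFibre_apply]
  exact Prime.isRelPrime_algebraMap _ hS ((MulEquiv.prime_iff (innerOuterEquiv k)).mpr hf)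
    (by rwa [map_dvd_iff])

theorem totalDegree_genericFibre_le {p : MvPolynomial (Fin 4) k} {n : ℕ} [Infinite k]
    (hp : p.IsHomogeneous n) (h : ∀ v : Fin 4 → k, v 0 = 0 → v 3 = 0 → eval v p = 0) :
    (genericFibre k p).totalDegree ≤ n - 1 := by
  have hmem : p ∈ Ideal.span (X '' {0, 3} : Set (MvPolynomial (Fin 4) k)) := by
    rw [← Ideal.Quotient.eq_zero_iff_mem]
    have h1 : (Ideal.Quotient.mkₐ k (Ideal.span (X '' {0, 3}))).comp
        (aeval ![0, X 1, X 2, 0] : MvPolynomial (Fin 4) k →ₐ[k] MvPolynomial (Fin 4) k) =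
        Ideal.Quotient.mkₐ k (Ideal.span (X '' {0, 3})) := by
      ext i
      fin_cases i
      · simp only [AlgHom.comp_apply, aeval_X]
        exact (map_zero _).trans (Ideal.Quotient.eq_zero_iff_mem.mpr
          (Ideal.subset_span (Set.mem_image_of_mem X (by simp)))).symm
      · simp
      · simp
      · simp only [AlgHom.comp_apply, aeval_X]
        exact (map_zero _).trans (Ideal.Quotient.eq_zero_iff_mem.mpr
          (Ideal.subset_span (Set.mem_image_of_mem X (by simp)))).symm
    have h2 : (aeval ![0, X 1, X 2, 0] p : MvPolynomial (Fin 4) k) = 0 :=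
      MvPolynomial.funext fun v => by
        rw [eval_aeval_eq, map_zero]
        exact h _ (by simp) (by simp)
    have h3 := congrArg (fun φ => φ p) h1
    simp only [AlgHom.comp_apply, h2, map_zero] at h3
    exact h3.symm
  rw [genericFibre, aeval_def, eval₂_eq']
  refine totalDegree_finsetSum_le fun m hm => ?_
  have hdeg := hp (mem_support_iff.mp hm)
  rw [Finsupp.weight_apply, Finsupp.sum_fintype _ _ (by simp)] at hdeg
  simp only [Pi.one_apply, smul_eq_mul, mul_one, Fin.sum_univ_four] at hdeg
  have hm' : m 0 ≠ 0 ∨ m 3 ≠ 0 := by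
    simpa using mem_ideal_span_X_image.mp hmem m hm
  simp only [Fin.prod_univ_four, Matrix.cons_val_zero, Matrix.cons_val_one, Matrix.cons_val,
    IsScalarTower.algebraMap_apply k (BinaryFunctionField k) (MvPolynomial _ _), algebraMap_eq,
    ← C_pow]
  have h4 : ∀ (a b c : BinaryFunctionField k) (i j : ℕ),
      (C a * (C b * X 0 ^ i * X 1 ^ j * C c) :
        MvPolynomial (Fin 2) (BinaryFunctionField k)).totalDegree ≤ i + j := by
    intro a b c i j
    have h5 : (C a * (C b * X 0 ^ i * X 1 ^ j * C c) :
        MvPolynomial (Fin 2) (BinaryFunctionField k)) = C (a * b * c) * (X 0 ^ i * X 1 ^ j) := by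
      simp only [C_mul]; ring
    rw [h5]
    refine (totalDegree_mul _ _).trans ?_
    rw [totalDegree_C, zero_add]
    refine (totalDegree_mul _ _).trans ?_
    rw [totalDegree_X_pow, totalDegree_X_pow]
  exact (h4 _ _ _ _ _).trans (by omega)

/-- The point in which the line through `a` and `b` meets the generic plane through `x = w = 0`. -/
noncomputable def lineGenericPoint (a b : Fin 4 → k) : Fin 2 → BinaryFunctionField k :=
  algebraMap (MvPolynomial (Fin 2) k) _ ∘
    ![C (a 1) * X 0 + C (b 1) * X 1, C (a 2) * X 0 + C (b 2) * X 1]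

theorem eval_lineGenericPoint_eq_zero [Infinite k] {p : MvPolynomial (Fin 4) k} {a b : Fin 4 → k}
    (ha : a 0 = 1 ∧ a 3 = 0) (hb : b 0 = 0 ∧ b 3 = 1) (h : ∀ s t : k, eval (s • a + t • b) p = 0) :
    eval (lineGenericPoint a b) (genericFibre k p) = 0 := by
  have h1 : (eval (lineGenericPoint a b)).comp (genericFibre k).toRingHom =
      (algebraMap (MvPolynomial (Fin 2) k) _).comp
        (aeval fun i => C (a i) * X 0 + C (b i) * X 1 :
          MvPolynomial (Fin 4) k →ₐ[k] MvPolynomial (Fin 2) k).toRingHom := by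
    ext i
    · simp [genericFibre, IsScalarTower.algebraMap_apply k (BinaryFunctionField k)
        (MvPolynomial (Fin 2) (BinaryFunctionField k)),
        IsScalarTower.algebraMap_apply k (MvPolynomial (Fin 2) k) (BinaryFunctionField k)]
    · fin_cases i <;> simp [genericFibre, lineGenericPoint, ha, hb]
  have h2 : (aeval (fun i => C (a i) * X 0 + C (b i) * X 1) p : MvPolynomial (Fin 2) k) = 0 :=
    MvPolynomial.funext fun v => by
      rw [eval_aeval_eq, map_zero, ← h (v 0) (v 1)]
      congr 2
      ext i; simp [mul_comm]
  have h3 := congrArg (fun φ => φ p) h1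
  simpa [-aeval_eq_bind₁, h2] using h3

theorem lineGenericPoint_inj {a b a' b' : Fin 4 → k}
    (h : lineGenericPoint a b = lineGenericPoint a' b') :
    (a 1 = a' 1 ∧ b 1 = b' 1) ∧ a 2 = a' 2 ∧ b 2 = b' 2 := by
  have h1 : ∀ {s t s' t' : k}, algebraMap _ (BinaryFunctionField k)
      (C s * X 0 + C t * X 1 : MvPolynomial (Fin 2) k) =
        algebraMap (MvPolynomial (Fin 2) k) _ (C s' * X 0 + C t' * X 1) → s = s' ∧ t = t' := by
    intro s t s' t' h
    have := IsFractionRing.injective _ _ h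
    constructor
    · simpa using congrArg (eval ![1, 0]) this
    · simpa using congrArg (eval ![0, 1]) this
  exact ⟨h1 (congrFun h 0), h1 (congrFun h 1)⟩

end GenericFibre

section LinesMeetingALine

variable {k : Type*} [Field k] {f : MvPolynomial (Fin 4) k} {d : ℕ}

/-- The line `x = w = 0`. -/
def sideAxis (k : Type*) [Field k] : Submodule k (Fin 4 → k) :=
  LinearMap.ker (LinearMap.proj 0) ⊓ LinearMap.ker (LinearMap.proj 3)

theorem mem_sideAxis {v : Fin 4 → k} : v ∈ sideAxis k ↔ v 0 = 0 ∧ v 3 = 0 := Iff.rfl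

theorem exists_basis_of_inf_sideAxis_eq_bot {N : Submodule k (Fin 4 → k)}
    (hN : Module.finrank k N = 2) (h : N ⊓ sideAxis k = ⊥) :
    ∃ a ∈ N, ∃ b ∈ N, (a 0 = 1 ∧ a 3 = 0) ∧ (b 0 = 0 ∧ b 3 = 1) ∧
      ∀ v ∈ N, v = v 0 • a + v 3 • b := by
  let π : N →ₗ[k] (Fin 2 → k) := LinearMap.pi ![LinearMap.proj 0, LinearMap.proj 3] ∘ₗ N.subtype
  have hπ : ∀ v, π v = ![v.1 0, v.1 3] := fun v => by ext i; fin_cases i <;> simp [π]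
  have heq : ∀ v ∈ N, ∀ w ∈ N, v 0 = w 0 → v 3 = w 3 → v = w := fun v hv w hw h0 h3 => by
    have : v - w ∈ N ⊓ sideAxis k :=
      ⟨N.sub_mem hv hw, mem_sideAxis.mpr ⟨by simp [h0], by simp [h3]⟩⟩
    rw [h, Submodule.mem_bot] at this
    exact sub_eq_zero.mp this
  have hinj : Function.Injective π := fun v w hvw => by
    rw [hπ, hπ] at hvw
    exact Subtype.ext (heq _ v.2 _ w.2 (by simpa using congrFun hvw 0)
      (by simpa using congrFun hvw 1))
  have hsurj := (LinearMap.injective_iff_surjective_of_finrank_eq_finrank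
    (by rw [hN, Module.finrank_fin_fun])).mp hinj
  obtain ⟨a, ha⟩ := hsurj ![1, 0]
  obtain ⟨b, hb⟩ := hsurj ![0, 1]
  rw [hπ] at ha hb
  have ha' : a.1 0 = 1 ∧ a.1 3 = 0 := ⟨by simpa using congrFun ha 0, by simpa using congrFun ha 1⟩
  have hb' : b.1 0 = 0 ∧ b.1 3 = 1 := ⟨by simpa using congrFun hb 0, by simpa using congrFun hb 1⟩
  exact ⟨a, a.2, b, b.2, ha', hb', fun v hv => heq _ hv _
    (N.add_mem (N.smul_mem _ a.2) (N.smul_mem _ b.2)) (by simp [ha', hb']) (by simp [ha', hb'])⟩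

variable [IsAlgClosed k]

theorem IsSmoothSurface.inf_sideAxis_eq_bot (hf : IsSmoothSurface f d)
    (hM : ∀ v ∈ axis k, eval v f = 0) (hL : ∀ v ∈ sideAxis k, eval v f = 0)
    {N : Submodule k (Fin 4 → k)} (hN : IsLineOn f N) (hMN : N ⊓ axis k ≠ ⊥)
    (hN0 : ¬ ∀ v ∈ N, v 0 = 0) : N ⊓ sideAxis k = ⊥ := by
  rw [Submodule.eq_bot_iff]
  intro v ⟨hvN, hv⟩
  by_contra hv0
  push Not at hN0
  obtain ⟨n, hnN, hn⟩ := hN0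
  obtain ⟨p, ⟨hpN, hp⟩, hp0⟩ := Submodule.exists_mem_ne_zero_of_ne_bot hMN
  let P := N ⊓ LinearMap.ker (LinearMap.proj 0 : (Fin 4 → k) →ₗ[k] k)
  have hlt : P < N := lt_of_le_of_ne inf_le_left fun h => hn (h.ge hnN).2
  have hP : Module.finrank k P ≤ 1 := by
    have := Submodule.finrank_lt_finrank_of_lt hlt
    rw [hN.1] at this
    omega
  obtain ⟨w, hw⟩ := finrank_le_one_iff.mp hP
  obtain ⟨c, hc⟩ := hw ⟨v, hvN, hv.1⟩
  obtain ⟨e, he⟩ := hw ⟨p, hpN, hp.1⟩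
  have hc' : c • w.1 = v := congrArg Subtype.val hc
  have he' : e • w.1 = p := congrArg Subtype.val he
  have hvM : v ∈ axis k := by
    rw [← hc']
    refine (axis k).smul_mem _ (((axis k).smul_mem_iff (s := e) ?_).mp (he' ▸ hp))
    rintro rfl
    exact hp0 (by rw [← he', zero_smul])
  have h0 : eval v (pderiv 0 f) = 0 := by
    have h1 := gradientAt_eq_zero_of_mem hN.2 hvN hnN
    have h2 := gradientAt_eq_zero_of_mem hL hv (w := Pi.single 1 1) (by simp [mem_sideAxis])
    have h3 := pderiv_eq_zero_of_mem_axis hM hvM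
    rw [gradientAt_single] at h2
    rw [gradientAt_fin_four, h2, h3.1, h3.2] at h1
    exact (mul_eq_zero.mp (by simpa using h1)).resolve_right hn
  have h1 : eval v (pderiv 1 f) = 0 := by
    rw [← gradientAt_single]
    exact gradientAt_eq_zero_of_mem hL hv (by simp [mem_sideAxis])
  exact hv0 (hf.eq_zero_of_mem_axis hM hvM h0 h1)

theorem IsSmoothSurface.card_lines_meeting_axis_le (hf : IsSmoothSurface f d) (hd : 2 ≤ d)
    (hM : ∀ v ∈ axis k, eval v f = 0) (hL : ∀ v ∈ sideAxis k, eval v f = 0)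
    (hfin : {W | IsLineOn f W}.Finite) (S : Finset (Submodule k (Fin 4 → k)))
    (hS : ∀ N ∈ S, IsLineOn f N ∧ N ⊓ axis k ≠ ⊥ ∧ ¬ ∀ v ∈ N, v 0 = 0) :
    S.card ≤ (d - 1) ^ 3 := by
  classical
  have hline : ∀ N ∈ S, ∀ v ∈ N, eval v (transversalForm f) = 0 := fun N hN v hv => by
    obtain ⟨p, ⟨hpN, hp⟩, hp0⟩ := Submodule.exists_mem_ne_zero_of_ne_bot (hS N hN).2.1
    exact eval_transversalForm_eq_zero hf.2.1 hM (hS N hN).1.2 hp hp0 hpN hv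
  have hside : ∀ v ∈ sideAxis k, eval v (transversalForm f) = 0 := fun v hv =>
    eval_transversalForm_eq_zero hf.2.1 hM hL (p := Pi.single 2 1) (by simp [mem_axis]) (by simp)
      (by simp [mem_sideAxis]) hv
  have hndvd := hf.not_dvd_transversalForm hd hM hfin
  have hne : ∀ {p}, p ≠ 0 → genericFibre k p ≠ 0 := fun hp =>
    (map_ne_zero_iff _ genericFibre_injective).mpr hp
  choose! a haN b hbN ha hb hab using fun N hN => exists_basis_of_inf_sideAxis_eq_bot
    (hS N hN).1.1 (hf.inf_sideAxis_eq_bot hM hL (hS N hN).1 (hS N hN).2.1 (hS N hN).2.2)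
  have hle : ∀ N ∈ S, ∀ N' ∈ S, lineGenericPoint (a N) (b N) = lineGenericPoint (a N') (b N') →
      N ≤ N' := fun N hN N' hN' h v hv => by
    obtain ⟨h1, h2⟩ := lineGenericPoint_inj h
    have haa : a N = a N' := by
      ext i; fin_cases i
      exacts [(ha N hN).1.trans (ha N' hN').1.symm, h1.1, h2.1,
        (ha N hN).2.trans (ha N' hN').2.symm]
    have hbb : b N = b N' := by
      ext i; fin_cases i
      exacts [(hb N hN).1.trans (hb N' hN').1.symm, h1.2, h2.2,
        (hb N hN).2.trans (hb N' hN').2.symm]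
    rw [hab N hN v hv, haa, hbb]
    exact N'.add_mem (N'.smul_mem _ (haN N' hN')) (N'.smul_mem _ (hbN N' hN'))
  have hbez := card_le_totalDegree_mul_totalDegree (hne hf.1)
    (hne fun h : transversalForm f = 0 => hndvd (h ▸ dvd_zero f))
    ((hf.irreducible (by omega)).prime.isRelPrime_genericFibre hndvd)
    (S.image fun N => lineGenericPoint (a N) (b N)) (by
      simp only [Finset.mem_image, forall_exists_index, and_imp]
      rintro _ N hN rfl
      have hmem : ∀ s t : k, s • a N + t • b N ∈ N := fun s t =>
        N.add_mem (N.smul_mem _ (haN N hN)) (N.smul_mem _ (hbN N hN))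
      exact ⟨eval_lineGenericPoint_eq_zero (ha N hN) (hb N hN) fun s t =>
        (hS N hN).1.2 _ (hmem s t), eval_lineGenericPoint_eq_zero (ha N hN) (hb N hN) fun s t =>
        hline N hN _ (hmem s t)⟩)
  rw [Finset.card_image_of_injOn fun N hN N' hN' h =>
    le_antisymm (hle N hN N' hN' h) (hle N' hN' N hN h.symm)] at hbez
  refine hbez.trans ((Nat.mul_le_mul
    (totalDegree_genericFibre_le hf.2.1 fun v h0 h3 => hL v (mem_sideAxis.mpr ⟨h0, h3⟩))
    (totalDegree_genericFibre_le (isHomogeneous_transversalForm hf.2.1) fun v h0 h3 =>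
      hside v (mem_sideAxis.mpr ⟨h0, h3⟩))).trans_eq ?_)
  rw [Nat.add_sub_cancel]
  ring

end LinesMeetingALine

section Incidence

variable {k : Type*} [Field k] {f : MvPolynomial (Fin 4) k} {d : ℕ}

theorem isLineOn_linSubst_iff (A : (Fin 4 → k) ≃ₗ[k] (Fin 4 → k)) {W : Submodule k (Fin 4 → k)} :
    IsLineOn (linSubst (A : (Fin 4 → k) →ₗ[k] (Fin 4 → k)) f) W ↔
      IsLineOn f (W.map (A : (Fin 4 → k) →ₗ[k] (Fin 4 → k))) := by
  rw [IsLineOn, IsLineOn, A.finrank_map_eq W]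
  simp only [eval_linSubst, LinearEquiv.coe_coe, Submodule.mem_map, forall_exists_index, and_imp,
    forall_apply_eq_imp_iff₂]

theorem finrank_sup_of_isLineOn {M N : Submodule k (Fin 4 → k)} (hM : IsLineOn f M)
    (hN : IsLineOn f N) (hne : M ≠ N) (hMN : M ⊓ N ≠ ⊥) :
    Module.finrank k (M ⊔ N : Submodule k (Fin 4 → k)) = 3 := by
  have h1 := Submodule.finrank_sup_add_finrank_inf_eq M N
  have h2 : Module.finrank k (M ⊓ N : Submodule k (Fin 4 → k)) ≠ 0 :=
    fun h => hMN (Submodule.finrank_eq_zero.mp h)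
  have h3 : Module.finrank k (M ⊓ N : Submodule k (Fin 4 → k)) < 2 := by
    rw [← hM.1]
    refine Submodule.finrank_lt_finrank_of_lt (lt_of_le_of_ne inf_le_left fun h => hne ?_)
    exact Submodule.eq_of_le_of_finrank_eq (inf_eq_left.mp h) (hM.1.trans hN.1.symm)
  rw [hM.1, hN.1] at h1
  omega

theorem inf_ne_bot_of_le_plane {M N P : Submodule k (Fin 4 → k)} (hP : Module.finrank k P = 3)
    (h : 3 < Module.finrank k M + Module.finrank k N) (hM : M ≤ P) (hN : N ≤ P) : M ⊓ N ≠ ⊥ := by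
  intro h0
  have h1 := Submodule.finrank_sup_add_finrank_inf_eq M N
  have h2 := Submodule.finrank_mono (sup_le hM hN)
  rw [h0, finrank_bot] at h1
  omega

/-- A basis of `k⁴` adapted to a pair of distinct lines which meet. -/
theorem exists_linearEquiv_of_inf_ne_bot {M N : Submodule k (Fin 4 → k)} (hM : IsLineOn f M)
    (hN : IsLineOn f N) (hne : M ≠ N) (hMN : M ⊓ N ≠ ⊥) :
    ∃ A : (Fin 4 → k) ≃ₗ[k] (Fin 4 → k), (∀ v, A v ∈ M ↔ v ∈ axis k) ∧
      (∀ v ∈ sideAxis k, A v ∈ N) ∧ ∀ v, v 0 = 0 → A v ∈ M ⊔ N := by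
  obtain ⟨e, ⟨heM, heN⟩, he⟩ := Submodule.exists_mem_ne_zero_of_ne_bot hMN
  obtain ⟨l, hlN, hl⟩ := SetLike.not_le_iff_exists.mp fun h : N ≤ M =>
    hne (Submodule.eq_of_le_of_finrank_eq h (hN.1.trans hM.1.symm)).symm
  obtain ⟨m, hmM, hm⟩ := SetLike.not_le_iff_exists.mp fun h : M ≤ k ∙ e => by
    have h1 := Submodule.finrank_mono h
    rw [hM.1, finrank_span_singleton he] at h1
    omega
  obtain ⟨n, -, hn⟩ := SetLike.not_le_iff_exists.mp fun h : ⊤ ≤ M ⊔ N => by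
    have h1 := Submodule.finrank_mono h
    rw [finrank_sup_of_isLineOn hM hN hne hMN, finrank_top, Module.finrank_fin_fun] at h1
    omega
  let B : (Fin 4 → k) →ₗ[k] (Fin 4 → k) := (LinearMap.proj 0).smulRight n +
    (LinearMap.proj 1).smulRight l + (LinearMap.proj 2).smulRight e +
    (LinearMap.proj 3).smulRight m
  have hB : ∀ v, B v = v 0 • n + v 1 • l + v 2 • e + v 3 • m := fun v => by simp [B]
  have hemM : ∀ v : Fin 4 → k, v 2 • e + v 3 • m ∈ M := fun v =>
    M.add_mem (M.smul_mem _ heM) (M.smul_mem _ hmM)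
  have hsup : ∀ v : Fin 4 → k, v 1 • l + (v 2 • e + v 3 • m) ∈ M ⊔ N := fun v =>
    Submodule.add_mem _ (Submodule.mem_sup_right (N.smul_mem _ hlN))
      (Submodule.mem_sup_left (hemM v))
  have hBM : ∀ v, B v ∈ M → v ∈ axis k := fun v hv => by
    rw [hB, add_assoc, add_assoc] at hv
    have h0 : v 0 = 0 := by
      by_contra h0
      exact hn (((M ⊔ N).smul_mem_iff h0).mp
        ((Submodule.add_mem_iff_left _ (hsup v)).mp (Submodule.mem_sup_left hv)))
    rw [h0, zero_smul, zero_add, M.add_mem_iff_left (hemM v)] at hv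
    refine mem_axis.mpr ⟨h0, ?_⟩
    by_contra h1
    exact hl ((M.smul_mem_iff h1).mp hv)
  have hinj : Function.Injective B := (injective_iff_map_eq_zero B).mpr fun v hv => by
    have hax := mem_axis.mp (hBM v (by rw [hv]; exact M.zero_mem))
    rw [hB, hax.1, hax.2, zero_smul, zero_smul, zero_add, zero_add] at hv
    have h3 : v 3 = 0 := by
      by_contra h3
      refine hm (((k ∙ e).smul_mem_iff h3).mp ?_)
      rw [eq_neg_of_add_eq_zero_right hv]
      exact Submodule.neg_mem _ (Submodule.smul_mem _ _ (Submodule.mem_span_singleton_self e))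
    rw [h3, zero_smul, add_zero] at hv
    have h2 := (smul_eq_zero.mp hv).resolve_right he
    ext i; fin_cases i
    exacts [hax.1, hax.2, h2, h3]
  have hA : ∀ v, LinearEquiv.ofInjectiveEndo B hinj v = B v := fun v => rfl
  refine ⟨LinearEquiv.ofInjectiveEndo B hinj, fun v => ⟨hBM v, fun hv => ?_⟩, fun v hv => ?_,
    fun v hv => ?_⟩
  · rw [hA, hB, (mem_axis.mp hv).1, (mem_axis.mp hv).2, zero_smul,
      zero_smul, zero_add, zero_add]
    exact hemM v
  · rw [hA, hB, (mem_sideAxis.mp hv).1, (mem_sideAxis.mp hv).2,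
      zero_smul, zero_smul, zero_add, add_zero]
    exact N.add_mem (N.smul_mem _ hlN) (N.smul_mem _ heN)
  · rw [hA, hB, hv, zero_smul, zero_add, add_assoc]
    exact hsup v

variable [IsAlgClosed k]

/-- On a smooth surface with finitely many lines, at most `(d - 1) ^ 3` lines meet a line `M`
outside a plane spanned by `M` and another line. -/
theorem IsSmoothSurface.card_lines_meeting_le (hf : IsSmoothSurface f d) (hd : 2 ≤ d)
    (hfin : {W | IsLineOn f W}.Finite) {M N : Submodule k (Fin 4 → k)} (hM : IsLineOn f M)
    (hN : IsLineOn f N) (hne : M ≠ N) (hMN : M ⊓ N ≠ ⊥) (S : Finset (Submodule k (Fin 4 → k)))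
    (hS : ∀ W ∈ S, IsLineOn f W ∧ W ⊓ M ≠ ⊥ ∧ ¬ W ≤ M ⊔ N) : S.card ≤ (d - 1) ^ 3 := by
  classical
  obtain ⟨A, hAM, hAN, hA0⟩ := exists_linearEquiv_of_inf_ne_bot hM hN hne hMN
  let B : (Fin 4 → k) →ₗ[k] (Fin 4 → k) := A.toLinearMap
  have hmap : ∀ W : Submodule k (Fin 4 → k), (W.comap B).map B = W :=
    Submodule.map_comap_eq_of_surjective A.surjective
  have hinj : Function.Injective (Submodule.comap B) :=
    Submodule.comap_injective_of_surjective A.surjective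
  rw [← Finset.card_image_of_injective S hinj]
  refine (hf.comp_linearEquiv A).card_lines_meeting_axis_le hd
    (fun v hv => ?_) (fun v hv => ?_) ?_ _ ?_
  · rw [eval_linSubst]
    exact hM.2 _ ((hAM v).mpr hv)
  · rw [eval_linSubst]
    exact hN.2 _ (hAN v hv)
  · exact (hfin.preimage (Submodule.map_injective_of_injective A.injective).injOn).subset
      fun W hW => (isLineOn_linSubst_iff A).mp hW
  · simp only [Finset.mem_image, forall_exists_index, and_imp]
    rintro _ W hW rfl
    obtain ⟨h1, h2, h3⟩ := hS W hW
    refine ⟨(isLineOn_linSubst_iff A).mpr (by rwa [hmap]), ?_, fun h => h3 fun w hw => ?_⟩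
    · obtain ⟨p, ⟨hpW, hpM⟩, hp0⟩ := Submodule.exists_mem_ne_zero_of_ne_bot h2
      refine (Submodule.ne_bot_iff _).mpr ⟨A.symm p, ⟨?_, (hAM _).mp ?_⟩, by simpa using hp0⟩
      · simpa [B] using hpW
      · simpa using hpM
    · have := hA0 (A.symm w) (h _ (by simpa [B] using hw))
      simpa using this

end Incidence

section Counting

variable {k : Type*} [Field k] {f : MvPolynomial (Fin 4) k} {d : ℕ}
  {H L M N : Submodule k (Fin 4 → k)}

theorem IsLineOn.sup_eq_plane (hH : Module.finrank k H = 3) (hM : IsLineOn f M) (hN : IsLineOn f N)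
    (hne : M ≠ N) (hMH : M ≤ H) (hNH : N ≤ H) : M ⊓ N ≠ ⊥ ∧ M ⊔ N = H := by
  have h : M ⊓ N ≠ ⊥ := inf_ne_bot_of_le_plane hH (by rw [hM.1, hN.1]; norm_num) hMH hNH
  exact ⟨h, Submodule.eq_of_le_of_finrank_eq (sup_le hMH hNH)
    ((finrank_sup_of_isLineOn hM hN hne h).trans hH.symm)⟩

/-- A line not contained in a plane meets it in a point. -/
theorem exists_inf_eq_span (hH : Module.finrank k H = 3) (hL : IsLineOn f L) (hLH : ¬ L ≤ H) :
    ∃ v ≠ 0, H ⊓ L = k ∙ v := by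
  have h1 := Submodule.finrank_sup_add_finrank_inf_eq H L
  have h2 : 3 < Module.finrank k (H ⊔ L : Submodule k (Fin 4 → k)) := by
    rw [← hH]
    exact Submodule.finrank_lt_finrank_of_lt (left_lt_sup.mpr hLH)
  have h3 := Submodule.finrank_le (H ⊔ L)
  rw [Module.finrank_fin_fun] at h3
  rw [hH, hL.1] at h1
  have h4 : Module.finrank k (H ⊓ L : Submodule k (Fin 4 → k)) = 1 := by omega
  obtain ⟨⟨v, hv⟩, hv0, hv1⟩ := finrank_eq_one_iff'.mp h4
  refine ⟨v, fun h => hv0 (Subtype.ext h), le_antisymm (fun w hw => ?_) ?_⟩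
  · obtain ⟨c, hc⟩ := hv1 ⟨w, hw⟩
    exact Submodule.mem_span_singleton.mpr ⟨c, congrArg Subtype.val hc⟩
  · rwa [Submodule.span_singleton_le_iff_mem]

variable [IsAlgClosed k]

/-- On a smooth surface, a line outside a plane meets at most one line of that plane. -/
theorem IsSmoothSurface.eq_of_le_of_inf_ne_bot (hf : IsSmoothSurface f d)
    (hH : Module.finrank k H = 3) (hL : IsLineOn f L) (hLH : ¬ L ≤ H) (hM : IsLineOn f M)
    (hMH : M ≤ H) (hML : M ⊓ L ≠ ⊥) (hN : IsLineOn f N) (hNH : N ≤ H) (hNL : N ⊓ L ≠ ⊥) :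
    N = M := by
  obtain ⟨v, hv, hHL⟩ := exists_inf_eq_span hH hL hLH
  have key : ∀ {W : Submodule k (Fin 4 → k)}, W ≤ H → W ⊓ L ≠ ⊥ → v ∈ W := fun {W} hW hWL => by
    obtain ⟨w, ⟨hwW, hwL⟩, hw⟩ := Submodule.exists_mem_ne_zero_of_ne_bot hWL
    have hwv : w ∈ k ∙ v := hHL ▸ ⟨hW hwW, hwL⟩
    obtain ⟨c, rfl⟩ := Submodule.mem_span_singleton.mp hwv
    exact (W.smul_mem_iff (fun h => hw (by rw [h, zero_smul]))).mp hwW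
  have hvL : v ∈ L := (hHL.ge (Submodule.mem_span_singleton_self v)).2
  by_contra hne
  refine hf.sup_ne_top hv hN hM hL (key hNH hNL) (key hMH hML) hvL ?_
  rw [(hN.sup_eq_plane hH hM hne hNH hMH).2]
  refine Submodule.eq_top_of_finrank_eq (le_antisymm (Submodule.finrank_le _) ?_)
  have := Submodule.finrank_lt_finrank_of_lt (left_lt_sup.mpr hLH)
  rw [hH] at this
  rw [Module.finrank_fin_fun]
  omega

/-- If a plane contains `d` lines of a smooth surface of degree `d`, every line of the surface
meets one of them. -/
theorem IsSmoothSurface.exists_line_inf_ne_bot (hf : IsSmoothSurface f d) (hd : 2 ≤ d)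
    (hH : Module.finrank k H = 3) (s : Finset (Submodule k (Fin 4 → k)))
    (hs : ∀ N ∈ s, IsLineOn f N ∧ N ≤ H) (hcard : s.card = d) (hL : IsLineOn f L)
    (hLH : ¬ L ≤ H) : ∃ M ∈ s, M ⊓ L ≠ ⊥ := by
  obtain ⟨v, hv, hHL⟩ := exists_inf_eq_span hH hL hLH
  obtain ⟨hvH, hvL⟩ := hHL.ge (Submodule.mem_span_singleton_self v)
  obtain ⟨M, hM, hvM⟩ := (hf.card_lines_in_plane_le hd hH s hs).2 hcard v hvH (hL.2 v hvL)
  exact ⟨M, hM, (Submodule.ne_bot_iff _).mpr ⟨v, ⟨hvM, hvL⟩, hv⟩⟩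

/-- Let `M` be a line common to two planes `H` and `P`. The number of lines meeting `M` outside `H`
is at most `(d - 1) ^ 3`, corrected by the difference of the numbers of lines in `P` and `H`. -/
theorem IsSmoothSurface.card_filter_meeting_add_le [DecidableEq (Submodule k (Fin 4 → k))]
    [DecidableRel fun M N : Submodule k (Fin 4 → k) => M ≤ N]
    (hf : IsSmoothSurface f d) (hd : 2 ≤ d) (hfin : {W | IsLineOn f W}.Finite)
    {P : Submodule k (Fin 4 → k)} (hH : Module.finrank k H = 3)
    (hP : Module.finrank k P = 3) (hM : IsLineOn f M) (hL : IsLineOn f L)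
    (hML : M ≠ L) (hMH : M ≤ H) (hMP : M ≤ P) (hLP : L ≤ P) :
    (hfin.toFinset.filter fun W => ¬ W ≤ H ∧ W ⊓ M ≠ ⊥).card +
        (hfin.toFinset.filter fun W => W ≤ H).card ≤
      (d - 1) ^ 3 + (hfin.toFinset.filter fun W => W ≤ P).card := by
  obtain ⟨hML0, hsup⟩ := hM.sup_eq_plane hP hL hML hMP hLP
  have h1 := hf.card_lines_meeting_le hd hfin hM hL hML hML0
    (hfin.toFinset.filter fun W => W ⊓ M ≠ ⊥ ∧ ¬ W ≤ P) fun W hW => by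
      rw [hsup]
      simpa using hW
  have h2 : (hfin.toFinset.filter fun W => ¬ W ≤ H ∧ W ⊓ M ≠ ⊥) ∪
      (hfin.toFinset.filter fun W => W ≤ H) ⊆
      (hfin.toFinset.filter fun W => W ⊓ M ≠ ⊥ ∧ ¬ W ≤ P) ∪
        (hfin.toFinset.filter fun W => W ≤ P) := by
    intro W
    simp only [Finset.mem_union, Finset.mem_filter, Set.Finite.mem_toFinset, Set.mem_ofPred_eq]
    rintro (⟨hW, -, hWM⟩ | ⟨hW, hWH⟩)
    · by_cases hWP : W ≤ P
      exacts [Or.inr ⟨hW, hWP⟩, Or.inl ⟨hW, hWM, hWP⟩]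
    · by_cases hWP : W ≤ P
      · exact Or.inr ⟨hW, hWP⟩
      · refine Or.inl ⟨hW, inf_ne_bot_of_le_plane hH ?_ hWH hMH, hWP⟩
        rw [hW.1, hM.1]
        norm_num
  rw [← Finset.card_union_of_disjoint]
  · exact (Finset.card_le_card h2).trans ((Finset.card_union_le _ _).trans (by gcongr))
  · rw [Finset.disjoint_filter]
    exact fun W _ h1 h2 => h1.1 h2

end Counting

theorem unique_line_in_full_plane_meeting {k : Type*} [Field k] [IsAlgClosed k]
    (d : ℕ) (hd : 3 ≤ d)
    (f : MvPolynomial (Fin 4) k) (hf : IsSmoothSurface f d)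
    (hcount : {W : Submodule k (Fin 4 → k) | IsLineOn f W}.ncard =
      d ^ 2 * (d ^ 2 - 3 * d + 3))
    (L : Submodule k (Fin 4 → k)) (hL : IsLineOn f L)
    (H : Submodule k (Fin 4 → k)) (hH : Module.finrank k H = 3)
    (hHd : {M : Submodule k (Fin 4 → k) | IsLineOn f M ∧ M ≤ H}.ncard = d)
    (hLH : ¬ L ≤ H) :
    ∃ M : Submodule k (Fin 4 → k),
      (IsLineOn f M ∧ M ≤ H ∧ M ⊓ L ≠ ⊥) ∧
      (∀ M' : Submodule k (Fin 4 → k), IsLineOn f M' → M' ≤ H → M' ⊓ L ≠ ⊥ → M' = M) ∧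
      (∀ P : Submodule k (Fin 4 → k), Module.finrank k P = 3 → L ≤ P → M ≤ P →
        {N : Submodule k (Fin 4 → k) | IsLineOn f N ∧ N ≤ P}.ncard = d) := by
  classical
  have hd2 : 2 ≤ d := by omega
  have hfin : {W : Submodule k (Fin 4 → k) | IsLineOn f W}.Finite :=
    Set.finite_of_ncard_pos (by rw [hcount]; positivity)
  have hncard : ∀ P : Submodule k (Fin 4 → k), {N | IsLineOn f N ∧ N ≤ P}.ncard =
      (hfin.toFinset.filter fun W => W ≤ P).card := fun P => by
    rw [← Set.ncard_coe_finset]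
    congr 1
    ext W
    simp
  have hmem : ∀ P : Submodule k (Fin 4 → k), ∀ N ∈ hfin.toFinset.filter fun W => W ≤ P,
      IsLineOn f N ∧ N ≤ P := fun P N hN => by simpa using hN
  rw [hncard] at hHd
  obtain ⟨M, hMs, hML⟩ := hf.exists_line_inf_ne_bot hd2 hH _ (hmem H) hHd hL hLH
  obtain ⟨hM, hMH⟩ := hmem H M hMs
  refine ⟨M, ⟨hM, hMH, hML⟩, fun N hN hNH hNL =>
    hf.eq_of_le_of_inf_ne_bot hH hL hLH hM hMH hML hN hNH hNL, fun P hP hLP hMP => ?_⟩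
  rw [hncard]
  refine le_antisymm (hf.card_lines_in_plane_le hd2 hP _ (hmem P)).1 ?_
  by_contra! hlt
  have hMlt : (hfin.toFinset.filter fun W => ¬ W ≤ H ∧ W ⊓ M ≠ ⊥).card < (d - 1) ^ 3 := by
    have := hf.card_filter_meeting_add_le hd2 hfin hH hP hM hL
      (fun h => hLH (h ▸ hMH)) hMH hMP hLP
    omega
  have hle : ∀ N ∈ hfin.toFinset.filter fun W => W ≤ H,
      (hfin.toFinset.filter fun W => ¬ W ≤ H ∧ W ⊓ N ≠ ⊥).card ≤ (d - 1) ^ 3 := fun N hN => by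
    obtain ⟨N', hN', hne⟩ := Finset.exists_mem_ne (hHd.symm ▸ hd2 : 1 < _) N
    obtain ⟨hN0, hNH⟩ := hmem H N hN
    obtain ⟨hN0', hNH'⟩ := hmem H N' hN'
    obtain ⟨h1, h2⟩ := hN0.sup_eq_plane hH hN0' hne.symm hNH hNH'
    refine hf.card_lines_meeting_le hd2 hfin hN0 hN0' hne.symm h1 _ fun W hW => ?_
    rw [h2]
    simp only [Finset.mem_filter, Set.Finite.mem_toFinset, Set.mem_ofPred_eq] at hW
    exact ⟨hW.1, hW.2.2, hW.2.1⟩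
  have hsub : hfin.toFinset ⊆ (hfin.toFinset.filter fun W => W ≤ H) ∪
      (hfin.toFinset.filter fun W => W ≤ H).biUnion fun N =>
        hfin.toFinset.filter fun W => ¬ W ≤ H ∧ W ⊓ N ≠ ⊥ := fun W hW => by
    by_cases hWH : W ≤ H
    · exact Finset.mem_union_left _ (Finset.mem_filter.mpr ⟨hW, hWH⟩)
    · obtain ⟨N, hN, hNW⟩ := hf.exists_line_inf_ne_bot hd2 hH _ (hmem H) hHd
        (hfin.mem_toFinset.mp hW) hWH
      refine Finset.mem_union_right _ (Finset.mem_biUnion.mpr ⟨N, hN, ?_⟩)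
      exact Finset.mem_filter.mpr ⟨hW, hWH, inf_comm N W ▸ hNW⟩
  have hsum := Finset.sum_lt_sum hle ⟨M, hMs, hMlt⟩
  rw [Finset.sum_const, hHd, smul_eq_mul] at hsum
  have htotal := (Finset.card_le_card hsub).trans
    ((Finset.card_union_le _ _).trans (Nat.add_le_add_left Finset.card_biUnion_le _))
  rw [← Set.ncard_eq_toFinset_card _ hfin, hcount, hHd] at htotal
  have hid : d ^ 2 * (d ^ 2 - 3 * d + 3) = d + d * (d - 1) ^ 3 := by
    obtain ⟨e, rfl⟩ := Nat.exists_eq_add_of_le hd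
    have h1 : (3 + e) ^ 2 - 3 * (3 + e) = (3 + e) * e := by
      rw [Nat.sub_eq_iff_eq_add (by nlinarith)]
      ring
    have h2 : 3 + e - 1 = 2 + e := by omega
    rw [h1, h2]
    ring
  omega
end

section
/- Let k be an algebraically closed field and let S = V(f) ⊆ P³ be a smooth surface of degree d ≥ 3 that contains a numerical star chord pair configuration. Then, after an invertible linear change of coordinates and rescaling, f has the form x·w·∏_{i=1}^{d−2} ℓᵢ + y·z·∏_{i=1}^{d−2} mᵢ: there exist A ∈ GL₄(k), a nonzero scalar c, and linear forms ℓ₁,…,ℓ_{d−2}, m₁,…,m_{d−2} in k[x,y,z,w] such that the 2d linear forms x, w, ℓ₁,…,ℓ_{d−2}, y, z, m₁,…,m_{d−2} are pairwise non-proportional and c·f(A·v) = v₀·v₃·∏ᵢ ℓᵢ(v) + v₁·v₂·∏ᵢ mᵢ(v) for all v ∈ k⁴. -/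
open MvPolynomial

/-- A numerical star chord pair configuration on `S = V(f)`: pairwise distinct planes
`H₁,…,H_d, K₁,…,K_d` (3-dimensional subspaces of `k⁴`) such that the `d²` subspaces
`Lᵢⱼ = Hᵢ ⊓ Kⱼ` are pairwise distinct lines, each lying on `S`. -/
def IsNSCPairConfig {k : Type*} [Field k] {d : ℕ} (f : MvPolynomial (Fin 4) k)
    (H K : Fin d → Submodule k (Fin 4 → k)) : Prop :=
  (∀ i, Module.finrank k (H i) = 3) ∧ (∀ i, Module.finrank k (K i) = 3) ∧
  Function.Injective H ∧ Function.Injective K ∧ (∀ i j, H i ≠ K j) ∧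
  (∀ i j m n, H i ⊓ K j = H m ⊓ K n → i = m ∧ j = n) ∧
  (∀ i j, IsLineOn f (H i ⊓ K j))

/-- The family of `n + 2` linear forms (given by their coefficient vectors)
`a, b, ℓ₁, …, ℓ_n`. -/
def famOf {k : Type*} [Field k] {n : ℕ} (a b : Fin 4 → k)
    (ℓ : Fin n → Fin 4 → k) : Fin (n + 2) → Fin 4 → k := fun i =>
  if h0 : (i : ℕ) = 0 then a
  else if h1 : (i : ℕ) = 1 then b
  else ℓ ⟨(i : ℕ) - 2, by have := i.isLt; omega⟩

/-- The restriction of `φ` to every affine line is a polynomial of degree at most `d`, whose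
coefficient of degree `d` is the value of `φ` at the direction of the line. -/
def IsFormOfDegree {k E : Type*} [Field k] [AddCommGroup E] [Module k E]
    (d : ℕ) (φ : E → k) : Prop :=
  ∀ a b : E, ∃ P : Polynomial k, P.natDegree ≤ d ∧ P.coeff d = φ b ∧
    ∀ s : k, P.eval s = φ (a + s • b)

namespace IsFormOfDegree

variable {k E : Type*} [Field k] [AddCommGroup E] [Module k E]

theorem const (c : k) : IsFormOfDegree 0 (fun _ : E => c) := fun _ _ =>
  ⟨Polynomial.C c, by simp, by simp, by simp⟩

theorem linear (l : Module.Dual k E) : IsFormOfDegree 1 (fun v => l v) := fun a b =>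
  ⟨Polynomial.C (l b) * Polynomial.X + Polynomial.C (l a), Polynomial.natDegree_linear_le,
    by simp [Polynomial.coeff_C], fun s => by simp; ring⟩

theorem mul {m n : ℕ} {φ ψ : E → k} (hφ : IsFormOfDegree m φ) (hψ : IsFormOfDegree n ψ) :
    IsFormOfDegree (m + n) (fun v => φ v * ψ v) := fun a b => by
  obtain ⟨P, hP, hPc, hPe⟩ := hφ a b
  obtain ⟨Q, hQ, hQc, hQe⟩ := hψ a b
  exact ⟨P * Q, Polynomial.natDegree_mul_le_of_le hP hQ,
    by rw [Polynomial.coeff_mul_add_eq_of_natDegree_le hP hQ, hPc, hQc],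
    fun s => by simp [hPe, hQe]⟩

theorem add {n : ℕ} {φ ψ : E → k} (hφ : IsFormOfDegree n φ) (hψ : IsFormOfDegree n ψ) :
    IsFormOfDegree n (fun v => φ v + ψ v) := fun a b => by
  obtain ⟨P, hP, hPc, hPe⟩ := hφ a b
  obtain ⟨Q, hQ, hQc, hQe⟩ := hψ a b
  exact ⟨P + Q, Polynomial.natDegree_add_le_of_degree_le hP hQ, by simp [hPc, hQc],
    fun s => by simp [hPe, hQe]⟩

theorem const_mul {n : ℕ} {φ : E → k} (c : k) (hφ : IsFormOfDegree n φ) :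
    IsFormOfDegree n (fun v => c * φ v) := by
  simpa using (const c).mul hφ

theorem sub {n : ℕ} {φ ψ : E → k} (hφ : IsFormOfDegree n φ) (hψ : IsFormOfDegree n ψ) :
    IsFormOfDegree n (fun v => φ v - ψ v) := by
  simpa [sub_eq_add_neg] using hφ.add (hψ.const_mul (-1))

theorem sum {ι : Type*} {n : ℕ} (s : Finset ι) {φ : ι → E → k}
    (hφ : ∀ i ∈ s, IsFormOfDegree n (φ i)) : IsFormOfDegree n (fun v => ∑ i ∈ s, φ i v) := by
  classical
  induction s using Finset.induction_on with
  | empty => exact fun _ _ => ⟨0, by simp, by simp, by simp⟩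
  | insert i s hi ih =>
    simp only [Finset.sum_insert hi]
    exact (hφ i (by simp)).add (ih fun j hj => hφ j (by simp [hj]))

theorem prod {ι : Type*} (s : Finset ι) {n : ι → ℕ} {φ : ι → E → k}
    (hφ : ∀ i ∈ s, IsFormOfDegree (n i) (φ i)) :
    IsFormOfDegree (∑ i ∈ s, n i) (fun v => ∏ i ∈ s, φ i v) := by
  classical
  induction s using Finset.induction_on with
  | empty => simpa using const 1
  | insert i s hi ih =>
    simp only [Finset.prod_insert hi, Finset.sum_insert hi]
    exact (hφ i (by simp)).mul (ih fun j hj => hφ j (by simp [hj]))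

theorem pow {n : ℕ} {φ : E → k} (hφ : IsFormOfDegree n φ) (m : ℕ) :
    IsFormOfDegree (m * n) (fun v => φ v ^ m) := by
  simpa using prod (Finset.range m) (n := fun _ => n) (φ := fun _ => φ) fun _ _ => hφ

theorem prod_linear {ι : Type*} [Fintype ι] (l : ι → Module.Dual k E) :
    IsFormOfDegree (Fintype.card ι) (fun v => ∏ i, l i v) := by
  simpa using prod Finset.univ fun i _ => linear (l i)

theorem restrict {n : ℕ} {φ : E → k} (hφ : IsFormOfDegree n φ) (W : Submodule k E) :
    IsFormOfDegree n (fun v : W => φ v) := fun a b => hφ a b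

theorem eval {σ : Type*} [Fintype σ] {f : MvPolynomial σ k} {d : ℕ} (hf : f.IsHomogeneous d) :
    IsFormOfDegree d (fun v : σ → k => MvPolynomial.eval v f) := by
  simp only [MvPolynomial.eval_eq']
  refine sum _ fun s hs => const_mul _ ?_
  have hd : ∑ i, s i * 1 = d := by
    rw [← hf (MvPolynomial.mem_support_iff.mp hs), Finsupp.weight_apply,
      Finsupp.sum_fintype _ _ (by simp)]
    simp
  rw [← hd]
  exact prod _ fun i _ => (linear (LinearMap.proj (R := k) (φ := fun _ => k) i)).pow (s i)

/-- A form vanishes as soon as it vanishes off finitely many hyperplanes. -/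
theorem eq_zero_of_forall_ne_zero [Infinite k] {ι : Type*} [Finite ι] {d : ℕ} {φ : E → k}
    (hφ : IsFormOfDegree d φ) (l : ι → Module.Dual k E) (hl : ∀ i, l i ≠ 0)
    (h : ∀ v, (∀ i, l i v ≠ 0) → φ v = 0) (v : E) : φ v = 0 := by
  cases nonempty_fintype ι
  obtain ⟨r, hr⟩ := Module.Dual.exists_forall_ne_zero_of_forall_exists l fun i => by
    by_contra! h0
    exact hl i (LinearMap.ext h0)
  obtain ⟨P, -, -, hP⟩ := hφ v r
  have hmul : P * ∏ i, (Polynomial.C (l i r) * Polynomial.X + Polynomial.C (l i v)) = 0 := by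
    refine Polynomial.funext fun s => ?_
    rw [Polynomial.eval_mul, Polynomial.eval_prod, hP, Polynomial.eval_zero, mul_eq_zero,
      Finset.prod_eq_zero_iff]
    by_contra! hne
    refine hne.1 (h _ fun i hi => hne.2 i (Finset.mem_univ i) ?_)
    rw [map_add, map_smul, smul_eq_mul] at hi
    simp only [Polynomial.eval_add, Polynomial.eval_mul, Polynomial.eval_C, Polynomial.eval_X]
    linear_combination hi
  have hP0 : P = 0 := by
    refine (mul_eq_zero.mp hmul).resolve_right fun h0 => ?_
    obtain ⟨i, -, hi⟩ := Finset.prod_eq_zero_iff.mp h0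
    exact hr i (by simpa [Polynomial.coeff_C] using congrArg (fun p => p.coeff 1) hi)
  simpa [hP0] using (hP 0).symm

/-- A form of degree `d` vanishing on `d` distinct hyperplanes is a scalar multiple of the product
of their equations. -/
theorem exists_eq_mul_prod [Infinite k] {ι : Type*} [Fintype ι] {φ : E → k}
    (hφ : IsFormOfDegree (Fintype.card ι) φ) (l : ι → Module.Dual k E) (hl : ∀ i, l i ≠ 0)
    (hker : Function.Injective fun i => LinearMap.ker (l i))
    (h : ∀ i v, l i v = 0 → φ v = 0) : ∃ c : k, ∀ v, φ v = c * ∏ i, l i v := by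
  obtain ⟨p, hp⟩ := Module.Dual.exists_forall_ne_zero_of_forall_exists l fun i => by
    by_contra! h0
    exact hl i (LinearMap.ext h0)
  have hp' : ∏ i, l i p ≠ 0 := Finset.prod_ne_zero_iff.mpr fun i _ => hp i
  refine ⟨φ p / ∏ i, l i p, fun v => sub_eq_zero.mp ?_⟩
  have hψ := hφ.sub ((prod_linear l).const_mul (φ p / ∏ i, l i p))
  refine hψ.eq_zero_of_forall_ne_zero
    (fun ij : {ij : ι × ι // ij.1 ≠ ij.2} => l ij.1.2 p • l ij.1.1 - l ij.1.1 p • l ij.1.2)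
    ?_ ?_ v
  · rintro ⟨⟨i, j⟩, hij⟩ h0
    refine hij (hker (Submodule.ext fun q => ?_))
    have hq : l j p * l i q = l i p * l j q := by
      simpa [sub_eq_zero] using LinearMap.congr_fun h0 q
    simp only [LinearMap.mem_ker]
    constructor <;> intro h1 <;> simpa [h1, hp i, hp j] using hq
  · intro q hq
    obtain ⟨P, hdeg, hcoeff, hP⟩ := hψ q p
    have hP0 : P = 0 := by
      refine Polynomial.eq_zero_of_degree_lt_of_eval_index_eq_zero (s := Finset.univ)
        (v := fun i => -(l i q / l i p)) ?_ ?_ ?_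
      · intro i _ j _ hij
        by_contra hne
        refine hq ⟨(i, j), hne⟩ ?_
        have hi := hp i
        have hj := hp j
        have hij' : l i q / l i p = l j q / l j p := neg_injective hij
        rw [div_eq_div_iff hi hj] at hij'
        simp only [LinearMap.sub_apply, LinearMap.smul_apply, smul_eq_mul]
        linear_combination hij'
      · rw [Finset.card_univ, Polynomial.degree_lt_iff_coeff_zero]
        intro m hm
        rcases hm.eq_or_lt with rfl | hm
        · simp only [hcoeff]
          rw [div_mul_cancel₀ _ hp', sub_self]
        · exact Polynomial.coeff_eq_zero_of_natDegree_lt (hdeg.trans_lt hm)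
      · intro i _
        have hi : l i (q + (-(l i q / l i p)) • p) = 0 := by
          have := hp i
          simp only [map_add, map_smul, smul_eq_mul]
          field_simp
          ring
        simp only [hP]
        have hprod : ∏ j, l j (q + (-(l i q / l i p)) • p) = 0 :=
          Finset.prod_eq_zero (Finset.mem_univ i) hi
        rw [h i _ hi, hprod, mul_zero, sub_zero]
    simpa [hP0] using (hP 0).symm

end IsFormOfDegree

section LinearForms

variable {k : Type*} [Field k]

/-- The linear polynomial attached to a linear form. -/
noncomputable def linearPolynomial {σ : Type*} [Fintype σ] [DecidableEq σ]
    (l : Module.Dual k (σ → k)) : MvPolynomial σ k :=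
  ∑ i, MvPolynomial.C (l (Pi.single i 1)) * MvPolynomial.X i

theorem dual_apply_eq_sum {σ : Type*} [Fintype σ] [DecidableEq σ]
    (l : Module.Dual k (σ → k)) (v : σ → k) : l v = ∑ i, l (Pi.single i 1) * v i := by
  conv_lhs => rw [LinearMap.pi_apply_eq_sum_univ l v]
  refine Finset.sum_congr rfl fun i _ => ?_
  rw [smul_eq_mul, mul_comm]
  congr 2
  ext j
  simp [Pi.single_apply, eq_comm]

@[simp]
theorem eval_linearPolynomial {σ : Type*} [Fintype σ] [DecidableEq σ]
    (l : Module.Dual k (σ → k)) (v : σ → k) :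
    MvPolynomial.eval v (linearPolynomial l) = l v := by
  simp [linearPolynomial, dual_apply_eq_sum l v]

theorem eval_pderiv_mul_mul_eq_zero {σ : Type*} {g₁ g₂ g₃ : MvPolynomial σ k} {v : σ → k}
    (h₁ : MvPolynomial.eval v g₁ = 0) (h₂ : MvPolynomial.eval v g₂ = 0) (i : σ) :
    MvPolynomial.eval v (MvPolynomial.pderiv i (g₁ * (g₂ * g₃))) = 0 := by
  simp [h₁, h₂]

/-- A point of a smooth surface `V(c ∏ lᵢ + e ∏ hᵢ)` is not a common zero of two of the `lᵢ` and two
of the `hᵢ`; factors of a product with zero coefficient may be ignored. -/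
theorem IsSmoothSurface.eq_zero_of_eval_eq [Infinite k] {m n : ℕ} {f : MvPolynomial (Fin 4) k}
    (hf : IsSmoothSurface f m) {h l : Fin (n + 2) → Module.Dual k (Fin 4 → k)} {c e : k}
    (hfe : ∀ v, MvPolynomial.eval v f = c * ∏ i, l i v + e * ∏ i, h i v) {p : Fin 4 → k}
    (hl : c = 0 ∨ l 0 p = 0 ∧ l 1 p = 0) (hh : e = 0 ∨ h 0 p = 0 ∧ h 1 p = 0) : p = 0 := by
  have key : f = MvPolynomial.C c * ∏ i, linearPolynomial (l i) +
      MvPolynomial.C e * ∏ i, linearPolynomial (h i) :=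
    MvPolynomial.funext fun v => by simp [hfe]
  have aux : ∀ (b : k) (g : Fin (n + 2) → Module.Dual k (Fin 4 → k)),
      (b = 0 ∨ g 0 p = 0 ∧ g 1 p = 0) →
      MvPolynomial.eval p (MvPolynomial.C b * ∏ i, linearPolynomial (g i)) = 0 ∧
      ∀ i, MvPolynomial.eval p
        (MvPolynomial.pderiv i (MvPolynomial.C b * ∏ i, linearPolynomial (g i))) = 0 := by
    rintro b g (rfl | ⟨h0, h1⟩)
    · simp
    · rw [Fin.prod_univ_succ, Fin.prod_univ_succ]
      refine ⟨by simp [h0], fun i => ?_⟩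
      rw [MvPolynomial.pderiv_C_mul, map_mul, eval_pderiv_mul_mul_eq_zero, mul_zero]
      · simpa using h0
      · simpa using h1
  by_contra hp
  refine hf.2.2 p hp ?_
  rw [key]
  refine ⟨?_, fun i => ?_⟩
  · rw [map_add, (aux c l hl).1, (aux e h hh).1, add_zero]
  · rw [map_add, map_add, (aux c l hl).2, (aux e h hh).2, add_zero]

theorem exists_ne_zero_of_two_dual {a b : Module.Dual k (Fin 4 → k)} :
    ∃ p, p ≠ 0 ∧ a p = 0 ∧ b p = 0 := by
  have hker : LinearMap.ker (a.prod b) ≠ ⊥ :=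
    LinearMap.ker_ne_bot_of_finrank_lt (by simp)
  obtain ⟨p, hp, hp0⟩ := Submodule.exists_mem_ne_zero_of_ne_bot hker
  exact ⟨p, hp0, by simpa using hp⟩

theorem exists_dual_ker_eq {W : Submodule k (Fin 4 → k)} (hW : Module.finrank k W = 3) :
    ∃ l : Module.Dual k (Fin 4 → k), l ≠ 0 ∧ LinearMap.ker l = W := by
  have hlt : W < ⊤ := by
    refine lt_top_iff_ne_top.mpr ?_
    rintro rfl
    simp at hW
  obtain ⟨l, hl, hle⟩ := Submodule.exists_le_ker_of_lt_top W hlt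
  refine ⟨l, hl, (Submodule.eq_of_le_of_finrank_eq hle ?_).symm⟩
  have := Module.Dual.finrank_ker_add_one_of_ne_zero hl
  simp at this
  omega

/-- The equation of a smooth surface containing a numerical star chord pair configuration is a sum
of two products of linear forms cutting out the planes of the configuration. -/
theorem IsNSCPairConfig.exists_eval_eq_prod_add_prod [Infinite k] {n : ℕ}
    {f : MvPolynomial (Fin 4) k} (hf : IsSmoothSurface f (n + 2))
    {H K : Fin (n + 2) → Submodule k (Fin 4 → k)} (hHK : IsNSCPairConfig f H K) :
    ∃ h l : Fin (n + 2) → Module.Dual k (Fin 4 → k),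
      (∀ i, LinearMap.ker (h i) = H i) ∧ (∀ i, LinearMap.ker (l i) = K i) ∧
      ∀ v, MvPolynomial.eval v f = ∏ i, h i v + ∏ i, l i v := by
  obtain ⟨hH, hK, Hinj, -, -, hdist, hline⟩ := hHK
  choose h h0 hker using fun i => exists_dual_ker_eq (hH i)
  choose l _ lker using fun i => exists_dual_ker_eq (hK i)
  have mem_H : ∀ i v, v ∈ H i ↔ h i v = 0 := fun i v => by rw [← hker, LinearMap.mem_ker]
  have mem_K : ∀ i v, v ∈ K i ↔ l i v = 0 := fun i v => by rw [← lker, LinearMap.mem_ker]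
  have hform : IsFormOfDegree (Fintype.card (Fin (n + 2)))
      (fun v => MvPolynomial.eval v f) := by
    simpa using IsFormOfDegree.eval hf.2.1
  have hplane : ∀ i, ∃ c : k, ∀ v ∈ H i, MvPolynomial.eval v f = c * ∏ j, l j v := by
    intro i
    suffices hc : ∃ c : k, ∀ v : H i, MvPolynomial.eval (v : Fin 4 → k) f =
        c * ∏ j, (l j).domRestrict (H i) v from
      hc.imp fun c hc v hv => hc ⟨v, hv⟩
    refine (hform.restrict (H i)).exists_eq_mul_prod _ (fun j hj => ?_) (fun j m hjm => ?_)
      (fun j v hv => ?_)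
    · have hle : H i ≤ K j := fun v hv =>
        (mem_K j v).mpr (LinearMap.congr_fun hj (⟨v, hv⟩ : H i))
      have h2 := (hline i j).1
      rw [inf_eq_left.mpr hle, hH] at h2
      omega
    · refine (hdist i j i m (Submodule.ext fun v => ?_)).2
      simp only [Submodule.mem_inf, mem_K]
      refine and_congr_right fun hv => ?_
      simpa using SetLike.ext_iff.mp hjm (⟨v, hv⟩ : H i)
    · exact (hline i j).2 v ⟨v.2, (mem_K j v).mpr hv⟩
  choose c hc using hplane
  have hc_eq : ∀ i, c i = c 0 := by
    intro i
    by_cases hi : i = 0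
    · rw [hi]
    obtain ⟨p, hp, hlp⟩ := Module.Dual.exists_forall_mem_ne_zero_of_forall_exists (H i ⊓ H 0) l
      fun j => by
        by_contra! hj
        have hle : H i ⊓ H 0 ≤ K j := fun v hv => (mem_K j v).mpr (hj v hv)
        have hfin : 2 ≤ Module.finrank k (H i ⊓ H 0 : Submodule k (Fin 4 → k)) := by
          have h1 := Submodule.finrank_sup_add_finrank_inf_eq (H i) (H 0)
          have h2 := Submodule.finrank_le (H i ⊔ H 0)
          rw [hH, hH] at h1
          rw [Module.finrank_fin_fun] at h2
          omega
        have h1 : H i ⊓ H 0 = H i ⊓ K j :=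
          Submodule.eq_of_le_of_finrank_le (le_inf inf_le_left hle)
            ((hline i j).1.trans_le hfin)
        have h2 : H i ⊓ H 0 = H 0 ⊓ K j :=
          Submodule.eq_of_le_of_finrank_le (le_inf inf_le_right hle)
            ((hline 0 j).1.trans_le hfin)
        exact hi (hdist i j 0 j (h1.symm.trans h2)).1
    have := (hc i p hp.1).symm.trans (hc 0 p hp.2)
    exact mul_right_cancel₀ (Finset.prod_ne_zero_iff.mpr fun j _ => hlp j) this
  obtain ⟨e, he⟩ := (hform.sub ((IsFormOfDegree.prod_linear l).const_mul (c 0))).exists_eq_mul_prod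
    h h0 (by simpa only [hker] using Hinj) fun i v hv => by
      simp only [hc i v ((mem_H i v).mpr hv), hc_eq i, sub_self]
  have hfe : ∀ v, MvPolynomial.eval v f = c 0 * ∏ j, l j v + e * ∏ i, h i v := fun v => by
    rw [← he v]
    ring
  have hc0 : c 0 ≠ 0 := by
    intro h00
    obtain ⟨p, hp, hp'⟩ := exists_ne_zero_of_two_dual (a := h 0) (b := h 1)
    exact hp (hf.eq_zero_of_eval_eq hfe (.inl h00) (.inr hp'))
  have he0 : e ≠ 0 := by
    intro h00
    obtain ⟨p, hp, hp'⟩ := exists_ne_zero_of_two_dual (a := l 0) (b := l 1)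
    exact hp (hf.eq_zero_of_eval_eq hfe (.inr hp') (.inl h00))
  have hscale : ∀ (b : k) (g : Fin (n + 2) → Module.Dual k (Fin 4 → k)), b ≠ 0 →
      ∃ g' : Fin (n + 2) → Module.Dual k (Fin 4 → k),
        (∀ i, LinearMap.ker (g' i) = LinearMap.ker (g i)) ∧
        ∀ v, ∏ i, g' i v = b * ∏ i, g i v := by
    intro b g hb
    refine ⟨fun i => (if i = 0 then b else 1) • g i, fun i => ?_, fun v => ?_⟩
    · exact LinearMap.ker_smul _ _ (by split_ifs <;> simp [hb])
    · simp only [LinearMap.smul_apply, smul_eq_mul, Finset.prod_mul_distrib,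
        Finset.prod_ite_eq', Finset.mem_univ, if_true]
  obtain ⟨h', hker', hprod⟩ := hscale e h he0
  obtain ⟨l', lker', lprod⟩ := hscale (c 0) l hc0
  exact ⟨h', l', fun i => (hker' i).trans (hker i), fun i => (lker' i).trans (lker i),
    fun v => by rw [hfe, hprod, lprod, add_comm]⟩

theorem famOf_eq {n : ℕ} (g : Fin (n + 2) → Fin 4 → k) :
    famOf (g 0) (g 1) (fun i => g i.succ.succ) = g := by
  funext i
  refine Fin.cases ?_ (fun i => Fin.cases ?_ (fun i => ?_) i) i
  · simp [famOf]
  · simp [famOf]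
  · simp [famOf]

theorem exists_normal_form [Infinite k] {n : ℕ} {f : MvPolynomial (Fin 4) k}
    (hf : IsSmoothSurface f (n + 2)) {H K : Fin (n + 2) → Submodule k (Fin 4 → k)}
    (hHK : IsNSCPairConfig f H K) :
    ∃ (A : Matrix (Fin 4) (Fin 4) k) (c : k) (ℓ m : Fin n → Fin 4 → k),
      IsUnit A ∧ c ≠ 0 ∧
      (∀ a b : Fin (n + 2) ⊕ Fin (n + 2), a ≠ b → ∀ t : k,
        Sum.elim (famOf (Pi.single 0 1) (Pi.single 3 1) ℓ)
            (famOf (Pi.single 1 1) (Pi.single 2 1) m) a ≠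
          t • Sum.elim (famOf (Pi.single 0 1) (Pi.single 3 1) ℓ)
            (famOf (Pi.single 1 1) (Pi.single 2 1) m) b) ∧
      ∀ v : Fin 4 → k,
        c * MvPolynomial.eval (A.mulVec v) f =
          v 0 * v 3 * (∏ i, ∑ j, ℓ i j * v j) + v 1 * v 2 * (∏ i, ∑ j, m i j * v j) := by
  obtain ⟨h, l, hker, lker, hfe⟩ := hHK.exists_eval_eq_prod_add_prod hf
  let T : (Fin 4 → k) →ₗ[k] (Fin 4 → k) := LinearMap.pi ![h 0, l 0, l 1, h 1]
  have hT : LinearMap.ker T = ⊥ := by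
    refine (Submodule.eq_bot_iff _).mpr fun p hp => ?_
    have hp' : ∀ i, T p i = 0 := fun i => congrFun hp i
    refine hf.eq_zero_of_eval_eq (c := 1) (e := 1) (l := l) (h := h) (p := p)
      (fun v => by rw [hfe]; ring) (.inr ⟨hp' 1, hp' 2⟩) (.inr ⟨hp' 0, hp' 3⟩)
  let e : (Fin 4 → k) ≃ₗ[k] (Fin 4 → k) :=
    LinearEquiv.ofInjectiveEndo T (LinearMap.ker_eq_bot.mp hT)
  have hTe : ∀ v, T (e.symm v) = v := fun v => e.apply_symm_apply v
  have coord : ∀ v, h 0 (e.symm v) = v 0 ∧ l 0 (e.symm v) = v 1 ∧ l 1 (e.symm v) = v 2 ∧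
      h 1 (e.symm v) = v 3 := fun v =>
    ⟨congrFun (hTe v) 0, congrFun (hTe v) 1, congrFun (hTe v) 2, congrFun (hTe v) 3⟩
  let coeffs : Module.Dual k (Fin 4 → k) → Fin 4 → k := fun g j => g (e.symm (Pi.single j 1))
  have coeffs_sum : ∀ g v, g (e.symm v) = ∑ j, coeffs g j * v j := fun g v =>
    dual_apply_eq_sum (g ∘ₗ e.symm.toLinearMap) v
  have coeffs_ne : ∀ g g' : Module.Dual k (Fin 4 → k), LinearMap.ker g ≠ ⊤ →
      LinearMap.ker g ≠ LinearMap.ker g' → ∀ t : k, coeffs g ≠ t • coeffs g' := by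
    intro g g' hg hne t heq
    have hgt : g = t • g' := LinearMap.ext fun v => by
      have := coeffs_sum g (e v)
      rw [heq] at this
      have h' := coeffs_sum g' (e v)
      rw [e.symm_apply_apply] at this h'
      simpa [h', Finset.mul_sum, mul_assoc] using this
    rcases eq_or_ne t 0 with rfl | ht
    · exact hg (by rw [hgt, zero_smul, LinearMap.ker_zero])
    · exact hne (by rw [hgt, LinearMap.ker_smul _ _ ht])
  have famh : famOf (Pi.single 0 1) (Pi.single 3 1) (fun i => coeffs (h i.succ.succ)) =
      fun i => coeffs (h i) := by
    rw [← famOf_eq fun i => coeffs (h i)]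
    congr 1 <;> funext j <;> simp [coeffs, coord, Pi.single_apply, eq_comm]
  have faml : famOf (Pi.single 1 1) (Pi.single 2 1) (fun i => coeffs (l i.succ.succ)) =
      fun i => coeffs (l i) := by
    rw [← famOf_eq fun i => coeffs (l i)]
    congr 1 <;> funext j <;> simp [coeffs, coord, Pi.single_apply, eq_comm]
  have ne_top : ∀ W : Submodule k (Fin 4 → k), Module.finrank k W = 3 → W ≠ ⊤ := by
    rintro W hW rfl
    simp at hW
  refine ⟨LinearMap.toMatrix' e.symm.toLinearMap, 1, fun i => coeffs (h i.succ.succ),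
    fun i => coeffs (l i.succ.succ), ?_, one_ne_zero, ?_, fun v => ?_⟩
  · rw [← Matrix.mulVec_injective_iff_isUnit]
    intro v w hvw
    simpa [LinearMap.toMatrix'_mulVec] using hvw
  · obtain ⟨hH, hK, Hinj, Kinj, hne, -, -⟩ := hHK
    rw [famh, faml]
    rintro (a | a) (b | b) hab t <;> simp only [Sum.elim_inl, Sum.elim_inr] <;>
      refine coeffs_ne _ _ ?_ ?_ t <;> simp only [hker, lker]
    · exact ne_top _ (hH a)
    · exact fun h => hab (congrArg _ (Hinj h))
    · exact ne_top _ (hH a)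
    · exact hne a b
    · exact ne_top _ (hK a)
    · exact (hne b a).symm
    · exact ne_top _ (hK a)
    · exact fun h => hab (congrArg _ (Kinj h))
  · simp only [LinearMap.toMatrix'_mulVec, LinearEquiv.coe_coe, one_mul, hfe,
      Fin.prod_univ_succ (n := n + 1), Fin.prod_univ_succ (n := n), ← coeffs_sum]
    obtain ⟨c0, c1, c2, c3⟩ := coord v
    simp only [Fin.succ_zero_eq_one, c0, c1, c2, c3, mul_assoc]

end LinearForms

theorem nsc_config_gives_normal_form {k : Type*} [Field k] [IsAlgClosed k]
    (d : ℕ) (hd : 3 ≤ d)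
    (f : MvPolynomial (Fin 4) k) (hf : IsSmoothSurface f d)
    (hconf : ∃ H K : Fin d → Submodule k (Fin 4 → k), IsNSCPairConfig f H K) :
    ∃ (A : Matrix (Fin 4) (Fin 4) k) (c : k) (ℓ m : Fin (d - 2) → Fin 4 → k),
      IsUnit A ∧ c ≠ 0 ∧
      (∀ a b : Fin (d - 2 + 2) ⊕ Fin (d - 2 + 2), a ≠ b → ∀ t : k,
        Sum.elim (famOf (Pi.single 0 1) (Pi.single 3 1) ℓ)
            (famOf (Pi.single 1 1) (Pi.single 2 1) m) a ≠
          t • Sum.elim (famOf (Pi.single 0 1) (Pi.single 3 1) ℓ)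
            (famOf (Pi.single 1 1) (Pi.single 2 1) m) b) ∧
      ∀ v : Fin 4 → k,
        c * MvPolynomial.eval (A.mulVec v) f =
          v 0 * v 3 * (∏ i, ∑ j, ℓ i j * v j) + v 1 * v 2 * (∏ i, ∑ j, m i j * v j) := by
  obtain ⟨n, rfl⟩ : ∃ n, d = n + 2 := ⟨d - 2, by omega⟩
  obtain ⟨H, K, hHK⟩ := hconf
  exact exists_normal_form hf hHK
end

section
/- Let k be an algebraically closed field and let S = V(f) ⊆ P³ be a smooth surface of degree d ≥ 3 with a numerical star chord pair configuration given by pairwise distinct planes H₁,…,H_d, K₁,…,K_d whose d² pairwise distinct intersections Lᵢⱼ = Hᵢ ∩ Kⱼ are lines on S. Then for all i ≠ j, the line Hᵢ ∩ Hⱼ does not lie on S, and the line Kᵢ ∩ Kⱼ does not lie on S. -/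
open MvPolynomial

namespace MvPolynomial

variable {σ k : Type*} [Field k]

/-- The univariate polynomial `t ↦ f (v + t w)`. -/
noncomputable def restrictLine (f : MvPolynomial σ k) (v w : σ → k) : Polynomial k :=
  aeval (fun i => Polynomial.C (w i) * Polynomial.X + Polynomial.C (v i)) f

theorem eval_restrictLine (f : MvPolynomial σ k) (v w : σ → k) (t : k) :
    (f.restrictLine v w).eval t = eval (v + t • w) f := by
  rw [restrictLine, ← Polynomial.coe_evalRingHom, aeval_def, hom_eval₂, eval, eval₂Hom]
  congr 1
  · ext; simp
  · funext i
    simp; ring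

theorem natDegree_restrictLine_le {f : MvPolynomial σ k} {d : ℕ} (hf : f.totalDegree ≤ d)
    (v w : σ → k) : (f.restrictLine v w).natDegree ≤ d := by
  rw [restrictLine, ← mul_one d]
  exact aeval_natDegree_le f hf _ fun _ => Polynomial.natDegree_linear_le

theorem derivative_restrictLine [Fintype σ] (f : MvPolynomial σ k) (v w : σ → k) :
    Polynomial.derivative (f.restrictLine v w) =
      ∑ i, Polynomial.C (w i) * (pderiv i f).restrictLine v w := by
  classical
  simp only [restrictLine]
  induction f using MvPolynomial.induction_on with
  | C a => simp
  | add p q hp hq => simp [hp, hq, mul_add, Finset.sum_add_distrib]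
  | mul_X p j hp =>
    have hterm (i : σ) :
        Polynomial.C (w i) *
            aeval (fun i => Polynomial.C (w i) * Polynomial.X + Polynomial.C (v i))
              (pderiv i (p * X j)) =
          Polynomial.C (w i) *
              aeval (fun i => Polynomial.C (w i) * Polynomial.X + Polynomial.C (v i))
                (pderiv i p) * (Polynomial.C (w j) * Polynomial.X + Polynomial.C (v j)) +
            if i = j then
              aeval (fun i => Polynomial.C (w i) * Polynomial.X + Polynomial.C (v i)) p *
                Polynomial.C (w j)
            else 0 := by
      rw [pderiv_mul, map_add, map_mul, map_mul, aeval_X]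
      split_ifs with hij
      · subst hij
        rw [pderiv_X_self, map_one]
        ring
      · rw [pderiv_X_of_ne (Ne.symm hij), map_zero]
        ring
    simp only [hterm, Finset.sum_add_distrib, ← Finset.sum_mul, ← hp]
    simp [Polynomial.derivative_mul]

theorem sum_mul_eval_pderiv_eq_zero [Infinite k] [Fintype σ] {f : MvPolynomial σ k}
    {W : Submodule k (σ → k)} (hW : ∀ v ∈ W, eval v f = 0) {v w : σ → k} (hv : v ∈ W)
    (hw : w ∈ W) : ∑ i, w i * eval v (pderiv i f) = 0 := by
  have h0 : f.restrictLine v w = 0 := Polynomial.funext fun t => by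
    simpa [eval_restrictLine] using hW _ (W.add_mem hv (W.smul_mem t hw))
  have h := congrArg (Polynomial.eval 0) (derivative_restrictLine f v w)
  simpa [h0, Polynomial.eval_finsetSum, eval_restrictLine] using h.symm

theorem IsHomogeneous.eval_smul_vec {g : MvPolynomial σ k} {n : ℕ} (hg : g.IsHomogeneous n)
    (c : k) (v : σ → k) : eval (c • v) g = c ^ n * eval v g := by
  rw [eval_eq, eval_eq, Finset.mul_sum]
  refine Finset.sum_congr rfl fun m hm => ?_
  have hdeg : m.degree = n := by
    rw [Finsupp.degree_eq_weight_one]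
    exact hg (mem_support_iff.1 hm)
  simp only [Pi.smul_apply, smul_eq_mul, mul_pow, Finset.prod_mul_distrib,
    Finset.prod_pow_eq_pow_sum, ← hdeg, Finsupp.degree_apply]
  ring

/-- A form of positive degree over an algebraically closed field has a nontrivial zero on the
span of two linearly independent vectors. -/
theorem IsHomogeneous.exists_zero_of_linearIndependent [IsAlgClosed k] {g : MvPolynomial σ k}
    {n : ℕ} (hg : g.IsHomogeneous n) (hn : n ≠ 0) {W : Submodule k (σ → k)} {a b : σ → k}
    (ha : a ∈ W) (hb : b ∈ W) (hab : LinearIndependent k ![a, b]) :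
    ∃ v ∈ W, v ≠ 0 ∧ eval v g = 0 := by
  rw [LinearIndependent.pair_iff] at hab
  by_cases hdeg : (g.restrictLine a b).degree = 0
  · obtain ⟨c, hc⟩ : ∃ c, g.restrictLine a b = Polynomial.C c :=
      ⟨_, Polynomial.eq_C_of_degree_eq_zero hdeg⟩
    refine ⟨b, hb, fun h => by simpa using hab 0 1 (by simp [h]), ?_⟩
    have key : g.restrictLine b a = Polynomial.C c * Polynomial.X ^ n := by
      refine Polynomial.eq_of_infinite_eval_eq _ _
        ((Set.finite_singleton (0 : k)).infinite_compl.mono ?_)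
      intro s (hs : s ≠ 0)
      have h1 : b + s • a = s • (a + s⁻¹ • b) := by
        rw [smul_add, smul_smul, mul_inv_cancel₀ hs, one_smul, add_comm]
      have h2 : eval (a + s⁻¹ • b) g = c := by rw [← eval_restrictLine, hc, Polynomial.eval_C]
      simp only [Set.mem_ofPred_eq, eval_restrictLine, h1, Polynomial.eval_mul, Polynomial.eval_C,
        Polynomial.eval_pow, Polynomial.eval_X]
      rw [← h2, mul_comm]
      exact hg.eval_smul_vec _ _
    have h := congrArg (Polynomial.eval 0) key
    simpa [eval_restrictLine, hn] using h
  · obtain ⟨t, ht⟩ := IsAlgClosed.exists_root _ hdeg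
    refine ⟨a + t • b, W.add_mem ha (W.smul_mem t hb), fun h => ?_, ?_⟩
    · simpa using (hab 1 t (by simpa using h)).1
    · rwa [← eval_restrictLine]

/-- A polynomial of degree at most `d` vanishing on more than `d` distinct hyperplanes of `H`
vanishes on `H`. -/
theorem eval_eq_zero_of_forall_inf_ker [Infinite k] {ι : Type*} [Fintype ι] {f : MvPolynomial σ k}
    {d : ℕ} (hf : f.totalDegree ≤ d) (hd : d < Fintype.card ι) {H : Submodule k (σ → k)}
    (φ : ι → Module.Dual k (σ → k)) (hinj : Function.Injective fun m => H ⊓ (φ m).ker)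
    (hne : ∀ m, ¬ H ≤ (φ m).ker) (hzero : ∀ m, ∀ v ∈ H ⊓ (φ m).ker, eval v f = 0) :
    ∀ v ∈ H, eval v f = 0 := by
  intro v hv
  by_cases hvφ : ∃ m, φ m v = 0
  · obtain ⟨m, hm⟩ := hvφ
    exact hzero m v ⟨hv, hm⟩
  push Not at hvφ
  obtain ⟨w, hwH, hw, hww⟩ : ∃ w ∈ H, (∀ m, φ m w ≠ 0) ∧
      ∀ m n, m ≠ n → φ m v * φ n w ≠ φ n v * φ m w := by
    by_contra! hcon
    let p : ι ⊕ {q : ι × ι // q.1 ≠ q.2} → Submodule k H := Sum.elim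
      (fun m => (φ m ∘ₗ H.subtype).ker)
      fun q => ((φ q.1.1 v • φ q.1.2 - φ q.1.2 v • φ q.1.1) ∘ₗ H.subtype).ker
    obtain ⟨i, hi⟩ := Subspace.exists_eq_top_of_iUnion_eq_univ (p := p) (by
      refine Set.eq_univ_of_forall fun w => Set.mem_iUnion.2 ?_
      by_cases hw : ∃ m, φ m w = 0
      · exact hw.imp' Sum.inl fun m hm => by simpa [p] using hm
      · push Not at hw
        obtain ⟨m, n, hmn, h⟩ := hcon w w.2 hw
        exact ⟨Sum.inr ⟨(m, n), hmn⟩, by simp [p, h]⟩)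
    have hi' : ∀ w (hw : w ∈ H), (⟨w, hw⟩ : H) ∈ p i := by simp [hi]
    rcases i with m | ⟨⟨m, n⟩, hmn⟩
    · exact hne m fun w hw => by simpa [p] using hi' w hw
    · refine hmn (hinj ?_)
      ext w
      simp only [Submodule.mem_inf, LinearMap.mem_ker]
      refine and_congr_right fun hw => ?_
      have h : φ m v * φ n w = φ n v * φ m w := by simpa [p, sub_eq_zero] using hi' w hw
      constructor <;> intro h'
      · simpa [h', hvφ] using h
      · simpa [h', hvφ] using h.symm
  have h0 : f.restrictLine v w = 0 := by
    refine Polynomial.eq_zero_of_natDegree_lt_card_of_eval_eq_zero _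
      (f := fun m => -(φ m v / φ m w)) ?_ ?_ ((natDegree_restrictLine_le hf v w).trans_lt hd)
    · intro m n hmn
      by_contra hne
      exact hww m n hne ((div_eq_div_iff (hw m) (hw n)).1 (neg_injective hmn))
    · intro m
      rw [eval_restrictLine]
      refine hzero m _ ⟨H.add_mem hv (H.smul_mem _ hwH), ?_⟩
      simp [hw m]
  simpa [h0] using (eval_restrictLine f v w 0).symm

end MvPolynomial

/-- A smooth surface of degree at least two contains no plane. -/
theorem IsSmoothSurface.not_forall_mem_plane {k : Type*} [Field k] [IsAlgClosed k]
    {f : MvPolynomial (Fin 4) k} {d : ℕ} (hf : IsSmoothSurface f d) (hd : 2 ≤ d)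
    {H : Submodule k (Fin 4 → k)} (hH : Module.finrank k H = 3) :
    ¬ ∀ v ∈ H, eval v f = 0 := by
  intro hzero
  have : Infinite k := IsAlgClosed.instInfinite
  have hlt : H < ⊤ := lt_top_iff_ne_top.2 fun h => by
    rw [h, finrank_top, Module.finrank_fin_fun] at hH
    omega
  obtain ⟨u, -, hu⟩ := SetLike.exists_of_lt hlt
  have hg : (∑ i, C (u i) * pderiv i f).IsHomogeneous (d - 1) :=
    IsHomogeneous.sum _ _ _ fun i _ => by
      simpa using (isHomogeneous_C _ (u i)).mul hf.2.1.pderiv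
  let e := Module.finBasisOfFinrankEq k H hH
  have he : LinearIndependent k ![(e 0 : Fin 4 → k), e 1] := by
    have h : ![(e 0 : Fin 4 → k), e 1] = (H.subtype ∘ e) ∘ ![0, 1] := by
      ext i : 1
      fin_cases i <;> rfl
    rw [h]
    exact (e.linearIndependent.map' H.subtype H.ker_subtype).comp _ (by decide)
  obtain ⟨v, hv, hv0, hvg⟩ :=
    hg.exists_zero_of_linearIndependent (by omega) (e 0).2 (e 1).2 he
  refine hf.2.2 v hv0 ⟨hzero v hv, ?_⟩
  let D : Module.Dual k (Fin 4 → k) :=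
    Fintype.linearCombination k fun i => eval v (pderiv i f)
  have hD (w : Fin 4 → k) : D w = ∑ i, w i * eval v (pderiv i f) := by
    simp [D, Fintype.linearCombination_apply]
  have hHD : H < D.ker := by
    refine SetLike.lt_iff_le_and_exists.2 ⟨fun w hw => ?_, u, ?_, hu⟩
    · rw [LinearMap.mem_ker, hD]
      exact sum_mul_eval_pderiv_eq_zero hzero hv hw
    · rw [LinearMap.mem_ker, hD]
      simpa using hvg
  have htop : D.ker = ⊤ := by
    apply Submodule.eq_top_of_finrank_eq
    have h1 := Submodule.finrank_lt_finrank_of_lt hHD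
    have h2 := Submodule.finrank_le D.ker
    simp only [Module.finrank_fin_fun] at h2 ⊢
    omega
  intro i
  have h : D (Pi.single i 1) = 0 := by rw [LinearMap.ker_eq_top.1 htop]; rfl
  simpa [hD, Pi.single_apply] using h

theorem Submodule.exists_ker_eq_of_finrank_add_one {k V : Type*} [Field k] [AddCommGroup V]
    [Module k V] [FiniteDimensional k V] {P : Submodule k V}
    (hP : Module.finrank k P + 1 = Module.finrank k V) : ∃ φ : Module.Dual k V, φ.ker = P := by
  have hlt : P < ⊤ := lt_top_iff_ne_top.2 fun h => by
    rw [h, finrank_top] at hP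
    omega
  obtain ⟨φ, hφ, hle⟩ := P.exists_le_ker_of_lt_top hlt
  refine ⟨φ, (Submodule.eq_of_le_of_finrank_le hle ?_).symm⟩
  have h := Submodule.finrank_lt (mt LinearMap.ker_eq_top.1 hφ)
  omega

theorem IsNSCPairConfig.symm {k : Type*} [Field k] {d : ℕ} {f : MvPolynomial (Fin 4) k}
    {H K : Fin d → Submodule k (Fin 4 → k)} (h : IsNSCPairConfig f H K) :
    IsNSCPairConfig f K H := by
  obtain ⟨hH, hK, hHi, hKi, hHK, hL, hS⟩ := h
  refine ⟨hK, hH, hKi, hHi, fun i j => (hHK j i).symm, fun i j m n h => ?_, fun i j => ?_⟩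
  · rw [inf_comm, inf_comm (K m)] at h
    exact (hL _ _ _ _ h).symm
  · rw [inf_comm]
    exact hS j i

theorem IsNSCPairConfig.not_forall_mem_inf {k : Type*} [Field k] [IsAlgClosed k] {d : ℕ}
    (hd : 2 ≤ d) {f : MvPolynomial (Fin 4) k} (hf : IsSmoothSurface f d)
    {H K : Fin d → Submodule k (Fin 4 → k)} (h : IsNSCPairConfig f H K) {i j : Fin d}
    (hij : i ≠ j) : ¬ ∀ v ∈ H i ⊓ H j, eval v f = 0 := by
  obtain ⟨hH, hK, hHi, hKi, hHK, hL, hS⟩ := h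
  intro hzero
  have : Infinite k := IsAlgClosed.instInfinite
  let P : Option (Fin d) → Submodule k (Fin 4 → k) := fun m => m.elim (H j) K
  have hP : ∀ m, Module.finrank k (P m) = 3 := by
    rintro (_ | m)
    exacts [hH j, hK m]
  have hPne : ∀ m, P m ≠ H i := by
    rintro (_ | m)
    exacts [hHi.ne hij.symm, (hHK i m).symm]
  have hlines : ∀ m, H i ⊓ H j ≠ H i ⊓ K m := fun m hm => hij <| by
    have hle : H i ⊓ K m ≤ H j ⊓ K m := le_inf (hm ▸ inf_le_right) inf_le_right
    have heq := Submodule.eq_of_le_of_finrank_eq hle ((hS i m).1.trans (hS j m).1.symm)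
    exact (hL _ _ _ _ heq).1
  choose φ hφ using fun m => Submodule.exists_ker_eq_of_finrank_add_one (P := P m) (by simp [hP])
  refine hf.not_forall_mem_plane hd (hH i)
    (eval_eq_zero_of_forall_inf_ker hf.2.1.totalDegree_le (by simp) φ ?_ ?_ ?_)
  · rintro (_ | m) (_ | n) hmn <;> simp only [hφ, P, Option.elim] at hmn
    · rfl
    · exact (hlines n hmn).elim
    · exact (hlines m hmn.symm).elim
    · rw [(hL _ _ _ _ hmn).2]
  · intro m hle
    rw [hφ] at hle
    exact hPne m (Submodule.eq_of_le_of_finrank_eq hle ((hH i).trans (hP m).symm)).symm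
  · intro m
    rw [hφ]
    rcases m with _ | m
    exacts [hzero, (hS i m).2]

theorem nsc_config_chords_not_on_surface {k : Type*} [Field k] [IsAlgClosed k]
    (d : ℕ) (hd : 3 ≤ d)
    (f : MvPolynomial (Fin 4) k) (hf : IsSmoothSurface f d)
    (H K : Fin d → Submodule k (Fin 4 → k)) (hconf : IsNSCPairConfig f H K) :
    ∀ i j, i ≠ j →
      (¬ ∀ v ∈ H i ⊓ H j, MvPolynomial.eval v f = 0) ∧
      (¬ ∀ v ∈ K i ⊓ K j, MvPolynomial.eval v f = 0) := by
  intro i j hij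
  exact ⟨hconf.not_forall_mem_inf (by omega) hf hij,
    hconf.symm.not_forall_mem_inf (by omega) hf hij⟩
end

section
/- Let k be an algebraically closed field and let S = V(f) ⊆ P³ be a smooth surface of degree d ≥ 3 with a numerical star chord pair configuration given by pairwise distinct planes H₁,…,H_d, K₁,…,K_d whose d² pairwise distinct intersections Lᵢⱼ = Hᵢ ∩ Kⱼ are lines on S. Then for all indices with i ≠ m and j ≠ n, the lines Lᵢⱼ and Lₘₙ are skew, i.e., Lᵢⱼ ∩ Lₘₙ = 0. -/
open MvPolynomial

namespace MvPolynomial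

/-- Chain rule for the substitution of univariate polynomials into a multivariate one. -/
theorem derivative_aeval {σ R : Type*} [Fintype σ] [CommRing R] (g : σ → Polynomial R)
    (f : MvPolynomial σ R) :
    Polynomial.derivative (aeval g f) =
      ∑ i, aeval g (pderiv i f) * Polynomial.derivative (g i) := by
  classical
  induction f using MvPolynomial.induction_on with
  | C a => simp
  | add p q hp hq => simp [hp, hq, add_mul, Finset.sum_add_distrib]
  | mul_X p j hp =>
    have hX (i : σ) : aeval g (pderiv i (p * X j)) =
        g j * aeval g (pderiv i p) + aeval g p * if j = i then 1 else 0 := by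
      rw [pderiv_mul, pderiv_X, map_add, map_mul, map_mul, aeval_X, Pi.single_apply,
        apply_ite (aeval g), map_one, map_zero]
      ring
    rw [map_mul, aeval_X, Polynomial.derivative_mul, hp]
    simp_rw [hX, add_mul, Finset.sum_add_distrib, Finset.sum_mul]
    simp [mul_assoc, mul_comm]

/-- If `f` vanishes on a linear subspace, then so does its differential at any of the points of
that subspace. -/
theorem sum_eval_pderiv_mul_eq_zero {σ k : Type*} [Fintype σ] [Field k] [Infinite k]
    {f : MvPolynomial σ k} {W : Submodule k (σ → k)} (hW : ∀ v ∈ W, eval v f = 0)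
    {p v : σ → k} (hp : p ∈ W) (hv : v ∈ W) :
    ∑ i, eval p (pderiv i f) * v i = 0 := by
  set g : σ → Polynomial k := fun i => Polynomial.C (p i) + Polynomial.X * Polynomial.C (v i)
    with hg
  have eval_aeval (t : k) (q : MvPolynomial σ k) :
      (aeval g q).eval t = eval (p + t • v) q := by
    rw [← Polynomial.coe_evalRingHom, aeval_def, hom_eval₂, eval_eq', eval₂_eq']
    simp [hg, mul_comm t]
  have hzero : aeval g f = 0 := Polynomial.funext fun t => by
    rw [eval_aeval, hW _ (W.add_mem hp (W.smul_mem t hv)), Polynomial.eval_zero]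
  have h := congrArg (Polynomial.eval 0) (derivative_aeval g f)
  rw [hzero, Polynomial.derivative_zero, Polynomial.eval_zero, Polynomial.eval_finsetSum] at h
  rw [h]
  refine Finset.sum_congr rfl fun i _ => ?_
  rw [Polynomial.eval_mul, eval_aeval]
  simp [hg]

end MvPolynomial

/-- A subspace is contained in `T` as soon as two distinct subspaces of codimension one in it
are. -/
theorem Submodule.le_of_finrank_eq_succ {k V : Type*} [Field k] [AddCommGroup V] [Module k V]
    [FiniteDimensional k V] {n : ℕ} {H A B T : Submodule k V}
    (hH : Module.finrank k H = n + 1) (hA : Module.finrank k A = n)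
    (hB : Module.finrank k B = n) (hAH : A ≤ H) (hBH : B ≤ H) (hAB : A ≠ B)
    (hAT : A ≤ T) (hBT : B ≤ T) : H ≤ T := by
  have hlt : n < Module.finrank k ↥(A ⊔ B) := by
    by_contra! hle
    exact hAB ((eq_of_le_of_finrank_le le_sup_left (hle.trans hA.ge)).trans
      (eq_of_le_of_finrank_le le_sup_right (hle.trans hB.ge)).symm)
  rw [← eq_of_le_of_finrank_le (sup_le hAH hBH) (by omega)]
  exact sup_le hAT hBT

theorem nsc_config_lines_skew {k : Type*} [Field k] [IsAlgClosed k]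
    (d : ℕ) (hd : 3 ≤ d)
    (f : MvPolynomial (Fin 4) k) (hf : IsSmoothSurface f d)
    (H K : Fin d → Submodule k (Fin 4 → k)) (hconf : IsNSCPairConfig f H K) :
    ∀ i j m n : Fin d, i ≠ m → j ≠ n → (H i ⊓ K j) ⊓ (H m ⊓ K n) = ⊥ := by
  obtain ⟨hH, hK, hHinj, -, -, hL, hline⟩ := hconf
  intro i j m n him hjn
  refine (Submodule.eq_bot_iff _).2 fun p hp => ?_
  by_contra hp0
  obtain ⟨⟨hpi, hpj⟩, hpm, hpn⟩ := hp
  let φ : (Fin 4 → k) →ₗ[k] k :=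
    ∑ l, MvPolynomial.eval p (MvPolynomial.pderiv l f) • LinearMap.proj l
  have hφ (v : Fin 4 → k) : φ v = ∑ l, MvPolynomial.eval p (MvPolynomial.pderiv l f) * v l := by
    simp [φ]
  have hle {a b : Fin d} (ha : p ∈ H a) (hb : p ∈ K b) : H a ⊓ K b ≤ LinearMap.ker φ :=
    fun v hv => (hφ v).trans
      (MvPolynomial.sum_eval_pderiv_mul_eq_zero (hline a b).2 ⟨ha, hb⟩ hv)
  have hHle {a : Fin d} (ha : p ∈ H a) : H a ≤ LinearMap.ker φ :=
    Submodule.le_of_finrank_eq_succ (hH a) (hline a j).1 (hline a n).1 inf_le_left inf_le_left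
      (fun h => hjn (hL _ _ _ _ h).2) (hle ha hpj) (hle ha hpn)
  have hker : LinearMap.ker φ ≠ ⊤ := fun htop => by
    refine hf.2.2 p hp0 ⟨(hline i j).2 p ⟨hpi, hpj⟩, fun l => ?_⟩
    simpa [LinearMap.ker_eq_top.1 htop, Pi.single_apply] using (hφ (Pi.single l 1)).symm
  have hrank : Module.finrank k (LinearMap.ker φ) ≤ 3 := by
    have := Submodule.finrank_lt hker
    rw [Module.finrank_fin_fun] at this
    omega
  exact him (hHinj ((Submodule.eq_of_le_of_finrank_le (hHle hpi) (hrank.trans (hH i).ge)).trans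
    (Submodule.eq_of_le_of_finrank_le (hHle hpm) (hrank.trans (hH m).ge)).symm))
end
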